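/- arXiv:2601.07950 — 11 statements merged into one kernel-verified Lean document; each statement's English description precedes it below -/
import Mathlib

section
/- Let m and M be positive integers. Then the Davenport constant of the interval ⟦-m,M⟧ satisfies D(⟦-m,M⟧) = m + M - ρ(m,M). -/
def IsMinZeroSum (S : Multiset ℤ) : Prop :=
  S.sum = 0 ∧ ∀ T : Multiset ℤ, T ≤ S → T ≠ 0 → T ≠ S → T.sum ≠ 0

noncomputable def davenport (m M : ℕ) : ℕ :=
  sSup {n : ℕ | ∃ S : Multiset ℤ, IsMinZeroSum S ∧
    (∀ x ∈ S, -(m : ℤ) ≤ x ∧ x ≤ (M : ℤ)) ∧ S.card = n}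

noncomputable def rho (m M : ℕ) : ℕ :=
  sInf {t : ℕ | ∃ t' : ℕ, t' ≤ t ∧
    Int.gcd ((M : ℤ) - (t' : ℤ)) ((m : ℤ) - ((t - t' : ℕ) : ℤ)) = 1}

/-- No nonempty proper part of `A` has the same sum as a part of `B`: a minimal zero-sum sequence
with positive part `A` and negative part `-B`. -/
def IsPrimitivePartition (A B : Multiset ℕ) : Prop :=
  0 ∉ A ∧ 0 ∉ B ∧ A.sum = B.sum ∧
    ∀ X ≤ A, ∀ Y ≤ B, X.sum = Y.sum → (X = 0 ∧ Y = 0) ∨ (X = A ∧ Y = B)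

theorem IsPrimitivePartition.symm {A B : Multiset ℕ} (h : IsPrimitivePartition A B) :
    IsPrimitivePartition B A :=
  ⟨h.2.1, h.1, h.2.2.1.symm, fun X hX Y hY hXY =>
    (h.2.2.2 Y hY X hX hXY.symm).imp And.symm And.symm⟩

theorem Multiset.sum_le_sum_of_le {X Y : Multiset ℕ} (h : X ≤ Y) : X.sum ≤ Y.sum := by
  obtain ⟨Z, rfl⟩ := Multiset.le_iff_exists_add.mp h
  rw [Multiset.sum_add]
  exact Nat.le_add_right _ _

theorem Multiset.sum_lt_sum_of_lt_of_zero_notMem {A D : Multiset ℕ} (hA : 0 ∉ A) (hD : D < A) :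
    D.sum < A.sum := by
  obtain ⟨a, ha⟩ := Multiset.lt_iff_cons_le.mp hD
  have h1 := Multiset.sum_le_sum_of_le ha
  have h2 : a ≠ 0 := by
    rintro rfl
    exact hA (Multiset.mem_of_le ha (Multiset.mem_cons_self _ _))
  rw [Multiset.sum_cons] at h1
  omega

namespace IsPrimitivePartition

variable {A B D E X X' Y Y' : Multiset ℕ}

theorem eq_zero_of_cast_sum_eq (h : IsPrimitivePartition A B) (hD : D < A) (hE : E < B)
    (hDE : (D.sum : ZMod A.sum) = E.sum) : D = 0 ∧ E = 0 := by
  have h1 := Multiset.sum_lt_sum_of_lt_of_zero_notMem h.1 hD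
  have h2 := Multiset.sum_lt_sum_of_lt_of_zero_notMem h.2.1 hE
  rw [ZMod.natCast_eq_natCast_iff', Nat.mod_eq_of_lt h1,
    Nat.mod_eq_of_lt (h.2.2.1 ▸ h2)] at hDE
  exact (h.2.2.2 D hD.le E hE.le hDE).resolve_right fun h => hD.ne h.1

theorem eq_zero_of_cast_sum_add_eq_zero (h : IsPrimitivePartition A B) (hD : D < A) (hE : E < B)
    (hDE : (D.sum : ZMod A.sum) + E.sum = 0) : D = 0 ∧ E = 0 := by
  have h1 := Multiset.sum_lt_sum_of_lt_of_zero_notMem h.1 hD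
  have h2 := Multiset.sum_lt_sum_of_lt_of_zero_notMem h.2.1 hE
  obtain ⟨F, rfl⟩ := Multiset.le_iff_exists_add.mp hE.le
  have h3 := h.2.2.1
  rw [Multiset.sum_add] at h2 h3
  have h4 : (D.sum : ZMod A.sum) = F.sum := by
    have : ((E.sum + F.sum : ℕ) : ZMod A.sum) = 0 := by rw [← h3, ZMod.natCast_self]
    rw [Nat.cast_add] at this
    linear_combination hDE - this
  rw [ZMod.natCast_eq_natCast_iff', Nat.mod_eq_of_lt h1] at h4
  rcases Nat.lt_or_ge F.sum A.sum with h5 | h5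
  · rw [Nat.mod_eq_of_lt h5] at h4
    rcases h.2.2.2 D hD.le F (Multiset.le_add_left _ _) h4 with ⟨-, rfl⟩ | ⟨h6, -⟩
    · simp at hE
    · exact absurd h6 hD.ne
  · have h6 : E.sum = 0 := by omega
    rw [show F.sum = A.sum by omega, Nat.mod_self] at h4
    have h7 := h.2.2.2 D hD.le E hE.le (by omega)
    exact h7.resolve_right fun h => hD.ne h.1

theorem eq_of_cast_sum_sub_eq (h : IsPrimitivePartition A B) (hX : X < A) (hX' : X' < A)
    (hY : Y < B) (hY' : Y' < B) (hXX : X ≤ X' ∨ X' ≤ X) (hYY : Y ≤ Y' ∨ Y' ≤ Y)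
    (heq : (X.sum : ZMod A.sum) - Y.sum = X'.sum - Y'.sum) : X = X' ∧ Y = Y' := by
  wlog hle : X ≤ X' generalizing X X' Y Y'
  · obtain ⟨h1, h2⟩ := this hX' hX hY' hY hXX.symm hYY.symm heq.symm (hXX.resolve_left hle)
    exact ⟨h1.symm, h2.symm⟩
  obtain ⟨D, rfl⟩ := Multiset.le_iff_exists_add.mp hle
  have hD := (Multiset.le_add_left D X).trans_lt hX'
  rw [Multiset.sum_add, Nat.cast_add] at heq
  rcases hYY with hYY | hYY <;> obtain ⟨E, rfl⟩ := Multiset.le_iff_exists_add.mp hYY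
  · have hE := (Multiset.le_add_left E Y).trans_lt hY'
    rw [Multiset.sum_add, Nat.cast_add] at heq
    obtain ⟨rfl, rfl⟩ := h.eq_zero_of_cast_sum_eq hD hE (by linear_combination -heq)
    simp
  · have hE := (Multiset.le_add_left E Y').trans_lt hY
    rw [Multiset.sum_add, Nat.cast_add] at heq
    obtain ⟨rfl, rfl⟩ := h.eq_zero_of_cast_sum_add_eq_zero hD hE (by linear_combination -heq)
    simp

theorem false_of_cast_sum_sub_eq {b K : ℕ} (h : IsPrimitivePartition A B) (hX : X < A)
    (hY : Y < B) (hb : K ≤ b) (hbB : b ::ₘ Y' ≤ B) (hYY : Y ≤ Y' ∨ b ::ₘ Y' ≤ Y)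
    (hlt : X'.sum < X.sum) (hltK : X.sum < X'.sum + K)
    (heq : (X.sum : ZMod A.sum) - Y.sum = X'.sum - Y'.sum) : False := by
  have h1 := Multiset.sum_lt_sum_of_lt_of_zero_notMem h.1 hX
  have h2 := Multiset.sum_lt_sum_of_lt_of_zero_notMem h.2.1 hY
  have h3 := h.2.2.1
  have h4 := Multiset.sum_le_sum_of_le hbB
  rw [Multiset.sum_cons] at h4
  have h5 : ((X.sum + Y'.sum : ℕ) : ZMod A.sum) = ((X'.sum + Y.sum : ℕ) : ZMod A.sum) := by
    rw [Nat.cast_add, Nat.cast_add]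
    linear_combination heq
  rw [Nat.cast_add, Nat.cast_add] at h5
  rcases hYY with hYY | hYY
  · have h6 := Multiset.sum_le_sum_of_le hYY
    have h7 : ((X.sum - X'.sum + (Y'.sum - Y.sum) : ℕ) : ZMod A.sum) = ((0 : ℕ) : ZMod A.sum) := by
      rw [Nat.cast_add, Nat.cast_sub hlt.le, Nat.cast_sub h6, Nat.cast_zero]
      linear_combination h5
    rw [ZMod.natCast_eq_natCast_iff', Nat.zero_mod, Nat.mod_eq_of_lt (by omega)] at h7
    omega
  · have h6 := Multiset.sum_le_sum_of_le hYY
    rw [Multiset.sum_cons] at h6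
    have h7 : ((X.sum - X'.sum : ℕ) : ZMod A.sum) = ((Y.sum - Y'.sum : ℕ) : ZMod A.sum) := by
      rw [Nat.cast_sub hlt.le, Nat.cast_sub (show Y'.sum ≤ Y.sum by omega)]
      linear_combination h5
    rw [ZMod.natCast_eq_natCast_iff', Nat.mod_eq_of_lt (by omega), Nat.mod_eq_of_lt (by omega)]
      at h7
    omega

end IsPrimitivePartition

theorem exists_chain (B : Multiset ℕ) (K : ℕ) : ∃ Q Q' : Finset (Multiset ℕ), Q' ⊆ Q ∧
    Q.card = B.card ∧ Q'.card = (B.filter (K ≤ ·)).card ∧ (∀ Y ∈ Q, Y < B) ∧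
    (∀ Y ∈ Q, ∀ Y' ∈ Q, Y ≤ Y' ∨ Y' ≤ Y) ∧
    ∀ Y' ∈ Q', ∃ b, K ≤ b ∧ b ::ₘ Y' ≤ B ∧ ∀ Y ∈ Q, Y ≤ Y' ∨ b ::ₘ Y' ≤ Y := by
  induction B using Multiset.induction with
  | empty => exact ⟨∅, ∅, by simp⟩
  | cons b B ih =>
    obtain ⟨Q, Q', hsub, hcard, hcard', hlt, hchain, hgap⟩ := ih
    have hinj : Function.Injective (Multiset.cons b) := fun X X' h => by simpa using h
    have h0 : ∀ R : Finset (Multiset ℕ), (0 : Multiset ℕ) ∉ R.image (Multiset.cons b) := by simp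
    have hltc : ∀ Y ∈ insert 0 (Q.image (Multiset.cons b)), Y < b ::ₘ B := by
      intro Y hY
      simp only [Finset.mem_insert, Finset.mem_image] at hY
      rcases hY with rfl | ⟨Y, hY, rfl⟩
      · exact (Multiset.zero_le _).lt_of_ne (Multiset.cons_ne_zero).symm
      · exact (Multiset.cons_lt_cons_iff).mpr (hlt Y hY)
    have hchainc : ∀ Y ∈ insert 0 (Q.image (Multiset.cons b)),
        ∀ Y' ∈ insert 0 (Q.image (Multiset.cons b)), Y ≤ Y' ∨ Y' ≤ Y := by
      intro Y hY Y' hY'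
      simp only [Finset.mem_insert, Finset.mem_image] at hY hY'
      rcases hY with rfl | ⟨Y, hY, rfl⟩
      · exact .inl (Multiset.zero_le _)
      rcases hY' with rfl | ⟨Y', hY', rfl⟩
      · exact .inr (Multiset.zero_le _)
      simpa using hchain Y hY Y' hY'
    have hgapc : ∀ Y' ∈ Q'.image (Multiset.cons b), ∃ c, K ≤ c ∧ c ::ₘ Y' ≤ b ::ₘ B ∧
        ∀ Y ∈ insert 0 (Q.image (Multiset.cons b)), Y ≤ Y' ∨ c ::ₘ Y' ≤ Y := by
      intro Y' hY'
      simp only [Finset.mem_image] at hY'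
      obtain ⟨Y', hY', rfl⟩ := hY'
      obtain ⟨c, hc, hle, hc'⟩ := hgap Y' hY'
      refine ⟨c, hc, by rwa [Multiset.cons_swap, Multiset.cons_le_cons_iff], ?_⟩
      intro Y hY
      simp only [Finset.mem_insert, Finset.mem_image] at hY
      rcases hY with rfl | ⟨Y, hY, rfl⟩
      · exact .inl (Multiset.zero_le _)
      rw [Multiset.cons_swap, Multiset.cons_le_cons_iff, Multiset.cons_le_cons_iff]
      exact hc' Y hY
    have hcardc : (insert 0 (Q.image (Multiset.cons b))).card = (b ::ₘ B).card := by
      rw [Finset.card_insert_of_notMem (h0 Q), Finset.card_image_of_injective _ hinj, hcard,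
        Multiset.card_cons]
    by_cases hb : K ≤ b
    · refine ⟨insert 0 (Q.image (Multiset.cons b)), insert 0 (Q'.image (Multiset.cons b)),
        Finset.insert_subset_insert _ (Finset.image_subset_image hsub), hcardc, ?_, hltc, hchainc,
        ?_⟩
      · rw [Finset.card_insert_of_notMem (h0 Q'), Finset.card_image_of_injective _ hinj, hcard',
          Multiset.filter_cons_of_pos _ hb, Multiset.card_cons]
      · intro Y' hY'
        rcases Finset.mem_insert.mp hY' with rfl | hY'
        · refine ⟨b, hb, by simp, ?_⟩
          intro Y hY
          simp only [Finset.mem_insert, Finset.mem_image] at hY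
          rcases hY with rfl | ⟨Y, hY, rfl⟩ <;> simp
        · exact hgapc Y' hY'
    · refine ⟨insert 0 (Q.image (Multiset.cons b)), Q'.image (Multiset.cons b),
        (Finset.image_subset_image hsub).trans (Finset.subset_insert _ _), hcardc, ?_, hltc,
        hchainc, hgapc⟩
      rw [Finset.card_image_of_injective _ hinj, hcard', Multiset.filter_cons_of_neg _ hb]

theorem exists_chain_with_alternatives (T : Multiset (ℕ × ℕ)) (C : Multiset ℕ) (K : ℕ)
    (hT : ∀ e ∈ T, e.1 < e.2 ∧ e.2 < e.1 + K) : ∃ P E : Finset (Multiset ℕ), Disjoint P E ∧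
    P.card = (T.map Prod.fst + T.map Prod.snd + C).card ∧ E.card = T.card ∧
    (∀ X ∈ P ∪ E, X < T.map Prod.fst + T.map Prod.snd + C) ∧
    (∀ X ∈ P, ∀ X' ∈ P, X ≤ X' ∨ X' ≤ X) ∧ (∀ X ∈ E, ∀ X' ∈ E, X ≤ X' ∨ X' ≤ X) ∧
    ∀ X ∈ P, ∀ X' ∈ E, (X ≤ X' ∨ X' ≤ X) ∨ (X'.sum < X.sum ∧ X.sum < X'.sum + K) := by
  induction T using Multiset.induction with
  | empty =>
    obtain ⟨Q, -, -, hcard, -, hlt, hchain, -⟩ := exists_chain C 0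
    exact ⟨Q, ∅, by simpa using ⟨hcard, hlt, hchain⟩⟩
  | cons e T ih =>
    obtain ⟨P, E, hdis, hP, hE, hlt, hPP, hEE, hPE⟩ :=
      ih fun e he => hT e (Multiset.mem_cons_of_mem he)
    obtain ⟨huv, hvK⟩ := hT e (Multiset.mem_cons_self _ _)
    obtain ⟨u, v⟩ := e
    dsimp only at huv hvK
    have hA : ((u, v) ::ₘ T).map Prod.fst + ((u, v) ::ₘ T).map Prod.snd + C =
        u ::ₘ v ::ₘ (T.map Prod.fst + T.map Prod.snd + C) := by
      simp only [Multiset.map_cons, Multiset.cons_add, Multiset.add_cons]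
      exact Multiset.cons_swap _ _ _
    rw [hA]
    generalize T.map Prod.fst + T.map Prod.snd + C = A at hP hlt
    set f : Multiset ℕ → Multiset ℕ := fun X => u ::ₘ v ::ₘ X with hf
    have hinj : Function.Injective f := fun X X' h => by simpa [hf] using h
    have hne : ∀ X, f X ≠ 0 ∧ f X ≠ {v} ∧ f X ≠ {u} := by
      intro X
      refine ⟨by simp [hf], fun h => ?_, fun h => ?_⟩ <;>
        simpa [hf] using congrArg Multiset.card h
    have hv : ∀ X, {v} ≤ f X := fun X => by simp [hf]
    have hu : ∀ X, {u} ≤ f X := fun X => by simp [hf]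
    have hff : ∀ X X', f X ≤ f X' ↔ X ≤ X' := fun X X' => by simp [hf]
    have hsum : ∀ X, (f X).sum = u + v + X.sum := fun X => by simp [hf, add_assoc]
    refine ⟨insert 0 (insert {v} (P.image f)), insert {u} (E.image f), ?_, ?_, ?_, ?_, ?_, ?_, ?_⟩
    · rw [Finset.disjoint_left] at hdis ⊢
      intro X hX hX'
      simp only [Finset.mem_insert, Finset.mem_image] at hX hX'
      rcases hX with rfl | rfl | ⟨X, hX, rfl⟩ <;> rcases hX' with h | ⟨X', hX', h⟩
      · simp at h
      · exact (hne X').1 h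
      · exact huv.ne' (Multiset.singleton_inj.mp h)
      · exact (hne X').2.1 h
      · exact (hne X).2.2 h
      · exact hdis hX (hinj h ▸ hX')
    · rw [Finset.card_insert_of_notMem, Finset.card_insert_of_notMem,
        Finset.card_image_of_injective _ hinj, hP, Multiset.card_cons, Multiset.card_cons]
      · simpa using fun X _ => (hne X).2.1
      · simpa using fun X _ => (hne X).1
    · rw [Finset.card_insert_of_notMem, Finset.card_image_of_injective _ hinj, hE,
        Multiset.card_cons]
      simpa using fun X _ => (hne X).2.2
    · intro X hX
      simp only [Finset.mem_union, Finset.mem_insert, Finset.mem_image] at hX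
      have hcard : ∀ Z : Multiset ℕ, Z ≤ f A → Z.card < A.card + 2 → Z < f A := fun Z h h' =>
        h.lt_of_ne (by rintro rfl; simp [hf] at h')
      rcases hX with (rfl | rfl | ⟨X, hX, rfl⟩) | (rfl | ⟨X, hX, rfl⟩)
      · exact hcard _ (Multiset.zero_le _) (by simp)
      · exact hcard _ (hv A) (by simp)
      · have := hlt X (Finset.mem_union_left _ hX)
        exact ((hff _ _).mpr this.le).lt_of_ne fun h => this.ne (hinj h)
      · exact hcard _ (hu A) (by simp)
      · have := hlt X (Finset.mem_union_right _ hX)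
        exact ((hff _ _).mpr this.le).lt_of_ne fun h => this.ne (hinj h)
    · intro X hX X' hX'
      simp only [Finset.mem_insert, Finset.mem_image] at hX hX'
      rcases hX with rfl | rfl | ⟨X, hX, rfl⟩ <;> rcases hX' with rfl | rfl | ⟨X', hX', rfl⟩
      all_goals first
        | exact .inl le_rfl
        | exact .inl (Multiset.zero_le _)
        | exact .inr (Multiset.zero_le _)
        | exact .inl (hv _)
        | exact .inr (hv _)
        | skip
      rw [hff, hff]
      exact hPP X hX X' hX'
    · intro X hX X' hX'
      simp only [Finset.mem_insert, Finset.mem_image] at hX hX'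
      rcases hX with rfl | ⟨X, hX, rfl⟩ <;> rcases hX' with rfl | ⟨X', hX', rfl⟩
      · exact .inl le_rfl
      · exact .inl (hu _)
      · exact .inr (hu _)
      · rw [hff, hff]
        exact hEE X hX X' hX'
    · intro X hX X' hX'
      simp only [Finset.mem_insert, Finset.mem_image] at hX hX'
      rcases hX with rfl | rfl | ⟨X, hX, rfl⟩ <;> rcases hX' with rfl | ⟨X', hX', rfl⟩
      · exact .inl (.inl (Multiset.zero_le _))
      · exact .inl (.inl (Multiset.zero_le _))
      · exact .inr (by simpa using ⟨huv, hvK⟩)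
      · exact .inl (.inl (hv _))
      · exact .inl (.inr (hu _))
      · rw [hff, hff, hsum, hsum]
        rcases hPE X hX X' hX' with h | h
        · exact .inl h
        · exact .inr (by omega)

theorem IsPrimitivePartition.card_mul_card_add_le {T : Multiset (ℕ × ℕ)} {A B C : Multiset ℕ}
    {K : ℕ} (hT : ∀ e ∈ T, e.1 < e.2 ∧ e.2 < e.1 + K)
    (hA : A = T.map Prod.fst + T.map Prod.snd + C) (h : IsPrimitivePartition A B)
    (hpos : 0 < A.sum) :
    A.card * B.card + T.card * (B.filter (K ≤ ·)).card ≤ A.sum := by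
  obtain ⟨P, E, hdis, hP, hE, hlt, hPP, hEE, hPE⟩ := exists_chain_with_alternatives T C K hT
  obtain ⟨Q, Q', hsub, hQ, hQ', hltQ, hchain, hgap⟩ := exists_chain B K
  rw [← hA] at hP hlt
  have : NeZero A.sum := ⟨hpos.ne'⟩
  have hdisj : Disjoint (P ×ˢ Q) (E ×ˢ Q') := Finset.disjoint_product.mpr (.inl hdis)
  rw [← hP, ← hQ, ← hE, ← hQ', ← Finset.card_product, ← Finset.card_product,
    ← Finset.card_union_of_disjoint hdisj]
  refine (Finset.card_le_card_of_injOn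
    (fun Z : Multiset ℕ × Multiset ℕ => (Z.1.sum : ZMod A.sum) - Z.2.sum)
    (t := Finset.univ) (by simp) ?_).trans (by simp [ZMod.card])
  have hmixed : ∀ X ∈ P, ∀ Y ∈ Q, ∀ X' ∈ E, ∀ Y' ∈ Q',
      (X.sum : ZMod A.sum) - Y.sum = X'.sum - Y'.sum → X = X' ∧ Y = Y' := by
    intro X hX Y hY X' hX' Y' hY' heq
    rcases hPE X hX X' hX' with hXX | ⟨h1, h2⟩
    · exact h.eq_of_cast_sum_sub_eq (hlt X (Finset.mem_union_left _ hX))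
        (hlt X' (Finset.mem_union_right _ hX')) (hltQ Y hY) (hltQ Y' (hsub hY')) hXX
        (hchain Y hY Y' (hsub hY')) heq
    · obtain ⟨b, hb, hbB, hYY⟩ := hgap Y' hY'
      exact (h.false_of_cast_sum_sub_eq (hlt X (Finset.mem_union_left _ hX)) (hltQ Y hY) hb hbB
        (hYY Y hY) h1 h2 heq).elim
  rintro ⟨X, Y⟩ hZ ⟨X', Y'⟩ hZ' heq
  simp only [Finset.coe_union, Finset.coe_product, Set.mem_union, Set.mem_prod, Finset.mem_coe]
    at hZ hZ'
  dsimp only at heq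
  rw [Prod.mk.injEq]
  rcases hZ with ⟨hX, hY⟩ | ⟨hX, hY⟩ <;> rcases hZ' with ⟨hX', hY'⟩ | ⟨hX', hY'⟩
  · exact h.eq_of_cast_sum_sub_eq (hlt X (Finset.mem_union_left _ hX))
      (hlt X' (Finset.mem_union_left _ hX')) (hltQ Y hY) (hltQ Y' hY') (hPP X hX X' hX')
      (hchain Y hY Y' hY') heq
  · exact hmixed X hX Y hY X' hX' Y' hY' heq
  · obtain ⟨h1, h2⟩ := hmixed X' hX' Y' hY' X hX Y hY heq.symm
    exact ⟨h1.symm, h2.symm⟩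
  · exact h.eq_of_cast_sum_sub_eq (hlt X (Finset.mem_union_right _ hX))
      (hlt X' (Finset.mem_union_right _ hX')) (hltQ Y (hsub hY)) (hltQ Y' (hsub hY'))
      (hEE X hX X' hX') (hchain Y (hsub hY) Y' (hsub hY')) heq

theorem four_mul_add_le_of_sum_bounds {m M p q t s r σ : ℤ} (hm : 0 < m) (ht : 0 ≤ t) (hp : p ≤ m)
    (hq : q ≤ M) (hpq : p + q + t = m + M) (htm : 6 * t ≤ m) (htM : 6 * t ≤ M) (hs : 0 ≤ s)
    (hsq : s ≤ q) (hr : 0 ≤ r) (hB : σ + (m - 2 * t) * s ≤ q * m)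
    (hAB : p * q + r * (q - s) ≤ σ) : 4 * t + s ≤ q ∧ (t = 0 → s = 0) := by
  have h1 : (m - 2 * t) * s ≤ q * (m - p) := by nlinarith [mul_nonneg hr (sub_nonneg.mpr hsq)]
  rcases ht.eq_or_lt with rfl | ht
  · obtain rfl : p = m := by linarith
    have hs0 : s = 0 := by nlinarith
    exact ⟨by linarith, fun _ => hs0⟩
  · have h2 : t * (4 * s) ≤ q * (m - p) := by nlinarith
    have h3 : q * (m - p) ≤ t * (4 * (q - 4 * t)) := by
      nlinarith [mul_nonneg (show 0 ≤ q - (5 * t + (m - p)) by linarith)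
        (show 0 ≤ 4 * t - (m - p) by linarith),
        mul_nonneg (show 0 ≤ t - (m - p) by linarith) (show 0 ≤ 2 * t + (m - p) by linarith)]
    have := le_of_mul_le_mul_left (h2.trans h3) ht
    exact ⟨by linarith, fun h => absurd h ht.ne'⟩

theorem add_two_mul_le_of_sum_bounds {m M p q t s r c σ : ℤ} (hm : 0 < m) (ht : 0 ≤ t)
    (hp : p ≤ m) (hq : q ≤ M) (hq0 : 0 < q) (hpq : p + q + t = m + M) (htm : 6 * t ≤ m)
    (hr : 0 ≤ r) (hc : 0 ≤ c) (hs : 4 * t + s ≤ q) (hs' : t = 0 → s = 0)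
    (hA : σ + (2 * t + 1) * c ≤ p * M) (hAB : p * q + r * (q - s) ≤ σ) :
    m + 2 * (c + 2 * r) ≤ 2 * p := by
  rcases ht.eq_or_lt with rfl | ht
  · obtain rfl : p = m := by linarith
    obtain rfl : q = M := by linarith
    rw [hs' rfl] at hAB
    have h1 : r * q ≤ 0 := by nlinarith
    have h2 : r = 0 := by nlinarith
    subst h2
    linarith
  · have h1 : t * (2 * (c + 2 * r)) ≤ p * (M - q) := by nlinarith
    have h2 : p * (M - q) ≤ t * (2 * p - m) := by
      obtain rfl : M = p + q + t - m := by linarith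
      nlinarith [mul_nonneg (sub_nonneg.mpr hp) (show 0 ≤ m - (t + (m - p)) by linarith)]
    have := le_of_mul_le_mul_left (h1.trans h2) ht
    linarith

theorem exists_pairs_add_replicate (U : Multiset ℕ) : ∃ (T : Multiset (ℕ × ℕ)) (k a : ℕ),
    U = T.map Prod.fst + T.map Prod.snd + Multiset.replicate k a ∧ ∀ e ∈ T, e.1 < e.2 := by
  induction U using Multiset.induction with
  | empty => exact ⟨0, 0, 0, by simp⟩
  | cons x U ih =>
    obtain ⟨T, k, a, rfl, hT⟩ := ih
    rcases k with - | k
    · exact ⟨T, 1, x, by simp [add_comm], hT⟩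
    rcases lt_trichotomy x a with h | rfl | h
    · refine ⟨(x, a) ::ₘ T, k, a, ?_, by simpa using ⟨h, fun y z => hT (y, z)⟩⟩
      simp only [Multiset.map_cons, Multiset.cons_add, Multiset.add_cons, Multiset.replicate_succ]
      exact Multiset.cons_swap _ _ _
    · exact ⟨T, k + 2, x, by simp only [Multiset.replicate_succ, Multiset.add_cons], hT⟩
    · refine ⟨(a, x) ::ₘ T, k, a, ?_, by simpa using ⟨h, fun y z => hT (y, z)⟩⟩
      simp only [Multiset.map_cons, Multiset.cons_add, Multiset.add_cons, Multiset.replicate_succ]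

theorem sum_add_mul_card_filter_le {A : Multiset ℕ} {P : ℕ → Prop} [DecidablePred P] {c M : ℕ}
    (hM : ∀ x ∈ A, x ≤ M) (hP : ∀ x ∈ A, P x → x + c ≤ M) :
    A.sum + c * (A.filter P).card ≤ A.card * M := by
  induction A using Multiset.induction with
  | empty => simp
  | cons x A ih =>
    have h1 := ih (fun y hy => hM y (Multiset.mem_cons_of_mem hy))
      fun y hy => hP y (Multiset.mem_cons_of_mem hy)
    have h2 := hM x (Multiset.mem_cons_self _ _)
    have h3 := hP x (Multiset.mem_cons_self _ _)
    rw [Multiset.sum_cons, Multiset.card_cons, add_mul, one_mul]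
    by_cases hx : P x
    · rw [Multiset.filter_cons_of_pos _ hx, Multiset.card_cons, mul_add, mul_one]
      have := h3 hx
      omega
    · rw [Multiset.filter_cons_of_neg _ hx]
      omega

namespace IsPrimitivePartition

variable {A B : Multiset ℕ}

theorem card_mul_card_le (h : IsPrimitivePartition A B) (hpos : 0 < A.sum) :
    A.card * B.card ≤ A.sum := by
  simpa using h.card_mul_card_add_le (T := 0) (C := A) (K := 0) (by simp) (by simp) hpos

theorem sum_pos (h : IsPrimitivePartition A B) (hA : 0 < A.card) : 0 < A.sum := by
  simpa using Multiset.sum_lt_sum_of_lt_of_zero_notMem h.1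
    ((Multiset.zero_le A).lt_of_ne (Multiset.card_pos.mp hA).symm)

theorem card_right_le {M : ℕ} (h : IsPrimitivePartition A B) (hA : 0 < A.card)
    (hM : ∀ x ∈ A, x ≤ M) : B.card ≤ M := by
  have h1 := h.card_mul_card_le (h.sum_pos hA)
  have h2 := Multiset.sum_le_card_nsmul A M hM
  exact Nat.le_of_mul_le_mul_left (h1.trans h2) hA

theorem exists_le_two_mul_count {m M t : ℕ} (h : IsPrimitivePartition A B) (hA : 0 < A.card)
    (hB : 0 < B.card) (hAM : ∀ x ∈ A, x ≤ M) (hBm : ∀ x ∈ B, x ≤ m)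
    (hcard : A.card + B.card + t = m + M) (hm : 0 < m) (htm : 6 * t ≤ m) (htM : 6 * t ≤ M) :
    ∃ a ∈ A, m ≤ 2 * A.count a ∧ B.card ≤ a := by
  have hpos := h.sum_pos hA
  have hqM := h.card_right_le hA hAM
  have hpm := h.symm.card_right_le hB hBm
  obtain ⟨T, k, a, hU, hT⟩ := exists_pairs_add_replicate (A.filter (M ≤ · + 2 * t))
  set V := A.filter (¬ M ≤ · + 2 * t) with hV
  have hUV : A = T.map Prod.fst + T.map Prod.snd + (Multiset.replicate k a + V) := by
    rw [← add_assoc, ← hU, hV, Multiset.filter_add_not]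
  have hUmem : ∀ x ∈ T.map Prod.fst + T.map Prod.snd + Multiset.replicate k a,
      x ≤ M ∧ M ≤ x + 2 * t := by
    intro x hx
    rw [← hU, Multiset.mem_filter] at hx
    exact ⟨hAM x hx.1, hx.2⟩
  have hfst : ∀ x ∈ T.map Prod.fst, x ≤ M ∧ M ≤ x + 2 * t := fun x hx =>
    hUmem x (by simp only [Multiset.mem_add, hx, true_or])
  have hsnd : ∀ x ∈ T.map Prod.snd, x ≤ M ∧ M ≤ x + 2 * t := fun x hx =>
    hUmem x (by simp only [Multiset.mem_add, hx, true_or, or_true])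
  have hcount := h.card_mul_card_add_le (T := T) (K := 2 * t + 1) (fun e he => ⟨hT e he, by
    have h1 := hfst e.1 (Multiset.mem_map_of_mem _ he)
    have h2 := hsnd e.2 (Multiset.mem_map_of_mem _ he)
    omega⟩) hUV hpos
  have hVsum := sum_add_mul_card_filter_le (A := A) (P := (¬ M ≤ · + 2 * t)) (c := 2 * t + 1) hAM
    fun x _ hx => by omega
  rw [← hV] at hVsum
  have hBsum := sum_add_mul_card_filter_le (A := B) (P := (¬ 2 * t + 1 ≤ ·)) (c := m - 2 * t) hBm
    fun x _ hx => by omega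
  rw [← h.2.2.1] at hBsum
  have hBcard := congrArg Multiset.card (Multiset.filter_add_not (2 * t + 1 ≤ ·) B)
  rw [Multiset.card_add] at hBcard
  have hAcard := congrArg Multiset.card hUV
  simp only [Multiset.card_add, Multiset.card_map, Multiset.card_replicate] at hAcard
  set s := (B.filter (¬ 2 * t + 1 ≤ ·)).card
  obtain hs : (B.filter (2 * t + 1 ≤ ·)).card = B.card - s := by omega
  rw [hs] at hcount
  obtain ⟨σ, hσ⟩ : ∃ σ, A.sum = σ := ⟨_, rfl⟩
  rw [hσ] at hcount hBsum hVsum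
  zify [show s ≤ B.card by omega, show 2 * t ≤ m by omega] at hcount hBsum hVsum
  obtain ⟨hX, hs0⟩ := four_mul_add_le_of_sum_bounds (m := m) (M := M)
    (p := A.card) (t := t) (s := s) (r := T.card) (σ := σ) (by omega) (by omega) (by omega)
    (by omega)
    (by omega) (by omega) (by omega) (by omega) (by omega) (by omega) hBsum hcount
  have hY := add_two_mul_le_of_sum_bounds (m := m) (M := M) (p := A.card) (q := B.card) (t := t)
    (s := s) (r := T.card) (c := V.card) (σ := σ) (by omega) (by omega) (by omega) (by omega)
    (by omega) (by omega) (by omega) (by omega) (by omega) hX hs0 hVsum hcount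
  have hk : m ≤ 2 * k := by omega
  have ha := hUmem a (by
    rw [Multiset.mem_add]
    exact .inr (Multiset.mem_replicate.mpr ⟨by omega, rfl⟩))
  have hka : k ≤ A.count a := by
    rw [Multiset.le_count_iff_replicate_le, hUV, ← add_assoc]
    exact (Multiset.le_add_left _ _).trans (Multiset.le_add_right _ _)
  refine ⟨a, Multiset.count_pos.mp (by omega), by omega, ?_⟩
  have h1 := Multiset.sum_le_card_nsmul _ M fun x hx => (hfst x hx).1
  have h2 := Multiset.sum_le_card_nsmul _ M fun x hx => (hsnd x hx).1
  have h3 : V.sum ≤ V.card • a := Multiset.sum_le_card_nsmul V a fun x hx => by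
    have := (Multiset.mem_filter.mp hx).2
    omega
  have h4 := congrArg Multiset.sum hUV
  simp only [Multiset.sum_add, Multiset.sum_replicate, Multiset.card_map, smul_eq_mul]
    at h1 h2 h3 h4
  by_contra! hlt
  have hp : (A.card : ℤ) = 2 * T.card + k + V.card := by omega
  have h5 : σ ≤ T.card * M + T.card * M + (k * a + V.card * a) := by omega
  zify at h5
  have h6 : (A.card : ℤ) * (a + 1) ≤ A.card * B.card :=
    mul_le_mul_of_nonneg_left (by omega) (by omega)
  have h7 : (T.card : ℤ) * (2 * (M - a)) ≤ T.card * (B.card - s) :=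
    mul_le_mul_of_nonneg_left (by omega) (by omega)
  rw [hp] at h6
  have h8 : (0 : ℤ) < A.card := by omega
  nlinarith

end IsPrimitivePartition
theorem exists_coprime_of_card_primeFactors_lt {u v : ℕ} (hu : 0 < u) (hv0 : v ≠ 0)
    (huv : Nat.Coprime u v)
    (hv : ∀ p ∈ v.primeFactors, v.primeFactors.card < p) (z : ℤ) :
    ∃ i < (v.primeFactors.card + 1) * u, Int.gcd (z - (i : ℤ)) ((u * v : ℕ) : ℤ) = 1 := by
  set k := v.primeFactors.card with hk
  obtain ⟨i₀, hi₀, c, hc⟩ : ∃ i₀ < u, (u : ℤ) ∣ z - i₀ - 1 := by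
    refine ⟨((z - 1) % u).toNat, ?_, ?_⟩
    · have := Int.emod_lt_of_pos (z - 1) (by exact_mod_cast hu : (0 : ℤ) < u)
      have := Int.emod_nonneg (z - 1) (by positivity : (u : ℤ) ≠ 0)
      omega
    · rw [Int.toNat_of_nonneg (Int.emod_nonneg _ (by positivity))]
      have := Int.dvd_self_sub_emod (x := z - 1) (m := (u : ℤ))
      rwa [show z - (z - 1) % u - 1 = z - 1 - (z - 1) % u by ring]
  have hcop : ∀ s : ℤ, IsCoprime (z - i₀ - s * u) (u : ℤ) := fun s =>
    ⟨1, s - c, by linear_combination hc⟩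
  by_contra! hcon
  have hprime : ∀ s : Fin (k + 1), ∃ p ∈ v.primeFactors,
      (p : ℤ) ∣ z - i₀ - ((s : ℕ) : ℤ) * u := by
    intro s
    have hlt : i₀ + s * u < (k + 1) * u := by
      have : (s : ℕ) ≤ k := Nat.lt_succ_iff.mp s.2
      nlinarith
    have hne := hcon _ hlt
    rw [show z - ((i₀ + s * u : ℕ) : ℤ) = z - i₀ - ((s : ℕ) : ℤ) * u by push_cast; ring] at hne
    by_contra! hno
    apply hne
    rw [← Int.isCoprime_iff_gcd_eq_one, Nat.cast_mul]
    refine (hcop _).mul_right ?_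
    rw [Int.isCoprime_iff_gcd_eq_one]
    by_contra hg
    obtain ⟨p, hp, hpd⟩ := Nat.exists_prime_and_dvd hg
    have hpv : p ∣ v := by
      have := (Int.natCast_dvd_natCast.mpr hpd).trans (Int.gcd_dvd_right _ _)
      exact_mod_cast this
    exact hno p (Nat.mem_primeFactors.mpr ⟨hp, hpv, hv0⟩)
      ((Int.natCast_dvd_natCast.mpr hpd).trans (Int.gcd_dvd_left _ _))
  choose f hf hfd using hprime
  obtain ⟨s, -, s', -, hne, heq⟩ := Finset.exists_ne_map_eq_of_card_lt_of_maps_to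
    (s := Finset.univ) (t := v.primeFactors) (f := f) (by simp [hk]) (fun s _ => hf s)
  have hp := Nat.prime_of_mem_primeFactors (hf s)
  have hpk := hv _ (hf s)
  have hdvd : (f s : ℤ) ∣ (((s : ℕ) : ℤ) - (s' : ℕ)) * u := by
    have := dvd_sub (heq ▸ hfd s') (hfd s)
    ring_nf at this ⊢
    exact this
  have hpu : IsCoprime (f s : ℤ) (u : ℤ) := by
    rw [Nat.isCoprime_iff_coprime]
    exact (huv.coprime_dvd_right (Nat.dvd_of_mem_primeFactors (hf s))).symm
  have h1 := Int.eq_zero_of_abs_lt_dvd (hpu.dvd_of_dvd_mul_right hdvd) (by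
    have := s.2
    have := s'.2
    rw [abs_lt]; omega)
  exact hne (Fin.ext (by omega))

theorem exists_coprime_small : ∀ m < 121, m ≠ 0 → m ≠ 6 → m ≠ 10 → ∀ r < m,
    ∃ i < m / 6 + 2, Nat.gcd (r + (m - i)) m = 1 := by
  decide +kernel

theorem divisors_cases : ∀ m ∈ Nat.divisors 27720, m < 121 ∨
    ∃ v ∈ [45, 63, 99, 35, 55, 77, 21, 33], v ∣ m ∧ Nat.Coprime (m / v) v := by
  decide +kernel

theorem exists_coprime_of_dvd_of_card_primeFactors_lt {m v k : ℕ} (hm : 0 < m) (hvm : v ∣ m)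
    (hco : Nat.Coprime (m / v) v) (hk : v.primeFactors.card = k)
    (hv : ∀ p ∈ v.primeFactors, k < p) (hkv : 6 * (k + 1) ≤ v) (z : ℤ) :
    ∃ i < m / 6 + 2, Int.gcd (z - (i : ℤ)) (m : ℤ) = 1 := by
  obtain ⟨u, rfl⟩ := hvm
  have hv0 : 0 < v := by omega
  rw [Nat.mul_div_cancel_left u hv0] at hco
  obtain ⟨i, hi, hgcd⟩ := exists_coprime_of_card_primeFactors_lt (u := u) (v := v)
    (Nat.pos_of_mul_pos_left hm) hv0.ne' hco (by rwa [hk]) z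
  refine ⟨i, ?_, by rwa [mul_comm v u]⟩
  rw [hk] at hi
  have : (k + 1) * u ≤ v * u / 6 := by
    rw [Nat.le_div_iff_mul_le (by norm_num)]
    nlinarith
  omega

theorem exists_coprime_in_run {m : ℕ} (h0 : m ≠ 0) (h6 : m ≠ 6) (h10 : m ≠ 10) (z : ℤ) :
    ∃ i < m / 6 + 2, Int.gcd (z - (i : ℤ)) (m : ℤ) = 1 := by
  have hm : 0 < m := by omega
  by_cases hsmall : m < 121
  · have hr0 := Int.emod_nonneg z (by exact_mod_cast h0 : (m : ℤ) ≠ 0)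
    have hr1 := Int.emod_lt_of_pos z (by exact_mod_cast hm : (0 : ℤ) < m)
    obtain ⟨i, hi, hg⟩ := exists_coprime_small m hsmall h0 h6 h10 (z % m).toNat (by omega)
    by_cases him : i ≤ m
    · refine ⟨i, hi, ?_⟩
      rw [← Int.gcd_natCast_natCast] at hg
      push_cast [Int.toNat_of_nonneg hr0, Nat.cast_sub him] at hg
      rw [← Int.isCoprime_iff_gcd_eq_one] at hg ⊢
      have hz := Int.emod_add_mul_ediv z m
      obtain ⟨a, b, hab⟩ := hg
      exact ⟨a, b + a * (1 - z / m), by linear_combination hab - a * hz⟩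
    · have : m = 1 := by omega
      subst this
      exact ⟨0, by norm_num, by simp⟩
  by_cases hpow : ∃ p, p.Prime ∧ 12 ≤ p ^ m.factorization p
  · obtain ⟨p, hp, h12⟩ := hpow
    have hfac : m.factorization p ≠ 0 := by
      intro h
      simp [h] at h12
    have hpf : (p ^ m.factorization p).primeFactors = {p} := Nat.primeFactors_prime_pow hfac hp
    refine exists_coprime_of_dvd_of_card_primeFactors_lt (k := 1) hm (Nat.ordProj_dvd m p)
      (Nat.Coprime.pow_right _ (Nat.coprime_ordCompl hp h0).symm) (by simp [hpf]) ?_ h12 z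
    simpa [hpf] using hp.one_lt
  · push Not at hpow
    have hdvd : m ∣ 27720 := by
      rw [Nat.dvd_iff_prime_pow_dvd_dvd]
      intro p k hp hpk
      have hle : p ^ k ∣ p ^ m.factorization p :=
        pow_dvd_pow p ((hp.pow_dvd_iff_le_factorization h0).mp hpk)
      have hlt := (Nat.le_of_dvd (pow_pos hp.pos _) hle).trans_lt (hpow p hp)
      have hpos := pow_pos hp.pos k
      generalize p ^ k = w at hlt hpos
      interval_cases w <;> norm_num
    obtain h | ⟨v, hv, hvm, hco⟩ := divisors_cases m (Nat.mem_divisors.mpr ⟨hdvd, by norm_num⟩)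
    · exact absurd h hsmall
    · have hv' : v.primeFactors.card = 2 ∧ (∀ p ∈ v.primeFactors, 2 < p) ∧ 18 ≤ v := by
        clear hvm hco
        revert v
        decide +kernel
      exact exists_coprime_of_dvd_of_card_primeFactors_lt hm hvm hco hv'.1 hv'.2.1 hv'.2.2 z

theorem six_mul_le_of_forall_gcd_ne_one {m t : ℕ} {M : ℤ} (hm : 0 < m)
    (h : ∀ i j : ℕ, i + j ≤ t → Int.gcd (M - i) ((m : ℤ) - j) ≠ 1) : 6 * t ≤ m := by
  by_contra! hlt
  by_cases hex : m = 6 ∨ m = 10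
  · have key : ∀ q : ℕ, q.Prime → (m - 1) ∣ q ^ 2 → False := by
      intro q hq hdvd
      have h0 := h 0 1 (by omega)
      have h1 := h 1 1 (by omega)
      have hdvd' : ((m : ℤ) - (1 : ℕ)) ∣ (q : ℤ) ^ 2 := by
        rw [← Nat.cast_sub hm]
        exact_mod_cast hdvd
      have aux : ∀ x : ℤ, Int.gcd x ((m : ℤ) - (1 : ℕ)) ≠ 1 → (q : ℤ) ∣ x := by
        intro x hx
        by_contra hqx
        apply hx
        rw [← Int.isCoprime_iff_gcd_eq_one]
        exact (((Nat.prime_iff_prime_int.mp hq).coprime_iff_not_dvd.mpr hqx).symm.pow_right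
          (n := 2)).of_isCoprime_of_dvd_right hdvd'
      have := dvd_sub (aux _ h0) (aux _ h1)
      simp only [Nat.cast_zero, Nat.cast_one, sub_zero, sub_sub_cancel] at this
      exact (Nat.prime_iff_prime_int.mp hq).not_dvd_one this
    rcases hex with rfl | rfl
    · exact key 5 (by norm_num) (by norm_num)
    · exact key 3 (by norm_num) (by norm_num)
  · push Not at hex
    obtain ⟨i, hi, hg⟩ := exists_coprime_in_run hm.ne' hex.1 hex.2 M
    exact h i 0 (by omega) (by simpa using hg)

namespace IsPrimitivePartition

variable {A B : Multiset ℕ}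

theorem two_mul_card_add_card_le {a b : ℕ} (h : IsPrimitivePartition A B)
    (ha : b ≤ 2 * A.count a)
    (hb : a ≤ 2 * B.count b) (hg : 2 ≤ a.gcd b) (ha0 : 0 < a) :
    2 * (A.card + B.card) ≤ a + b := by
  obtain ⟨a', ha'⟩ := Nat.gcd_dvd_left a b
  obtain ⟨b', hb'⟩ := Nat.gcd_dvd_right a b
  set d := a.gcd b
  have hba : 2 * b' ≤ b := by nlinarith
  have hab : 2 * a' ≤ a := by nlinarith
  have key := h.2.2.2 (Multiset.replicate b' a)
    ((Multiset.le_count_iff_replicate_le).mp (by omega)) (Multiset.replicate a' b)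
    ((Multiset.le_count_iff_replicate_le).mp (by omega)) (by
      simp only [Multiset.sum_replicate, smul_eq_mul]
      linear_combination b' * ha' - a' * hb')
  rcases key with ⟨-, h0⟩ | ⟨hX, hY⟩
  · have := congrArg Multiset.card h0
    simp only [Multiset.card_replicate, Multiset.card_zero] at this
    subst this
    omega
  · rw [← hX, ← hY, Multiset.card_replicate, Multiset.card_replicate]
    omega

theorem exists_gcd_eq_one {m M t : ℕ} (h : IsPrimitivePartition A B) (hA : 0 < A.card)
    (hB : 0 < B.card) (hAM : ∀ x ∈ A, x ≤ M) (hBm : ∀ x ∈ B, x ≤ m)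
    (hcard : A.card + B.card + t = m + M) (hm : 0 < m) (hM : 0 < M) :
    ∃ i j : ℕ, i + j ≤ t ∧ Int.gcd ((M : ℤ) - i) ((m : ℤ) - j) = 1 := by
  by_contra! hno
  have htm := six_mul_le_of_forall_gcd_ne_one hm hno
  have htM := six_mul_le_of_forall_gcd_ne_one (t := t) (M := m) hM fun i j hij => by
    rw [Int.gcd_comm]
    exact hno j i (by omega)
  obtain ⟨a, haA, ham, hqa⟩ := h.exists_le_two_mul_count hA hB hAM hBm hcard hm htm htM
  obtain ⟨b, hbB, hbM, hpb⟩ := h.symm.exists_le_two_mul_count hB hA hBm hAM (by omega) hM htM htm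
  have haM := hAM a haA
  have hbm := hBm b hbB
  have hg := hno (M - a) (m - b) (by omega)
  rw [Nat.cast_sub haM, Nat.cast_sub hbm, sub_sub_cancel, sub_sub_cancel, Int.gcd_natCast_natCast]
    at hg
  have ha0 : 0 < a := by omega
  have hg0 := Nat.gcd_pos_of_pos_left b ha0
  have := h.two_mul_card_add_card_le (ham.trans' hbm) (hbM.trans' haM) (by omega) ha0
  omega

end IsPrimitivePartition

theorem exists_eq_map_add_map_neg (S : Multiset ℤ) (hS : 0 ∉ S) : ∃ A B : Multiset ℕ,
    S = A.map (fun x : ℕ => (x : ℤ)) + B.map (fun x : ℕ => -(x : ℤ)) ∧ 0 ∉ A ∧ 0 ∉ B := by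
  induction S using Multiset.induction with
  | empty => exact ⟨0, 0, by simp⟩
  | cons x S ih =>
    simp only [Multiset.mem_cons, not_or] at hS
    obtain ⟨A, B, rfl, hA, hB⟩ := ih hS.2
    rcases lt_or_gt_of_ne hS.1 with hx | hx
    · refine ⟨x.toNat ::ₘ A, B, ?_, ?_, hB⟩
      · rw [Multiset.map_cons, Multiset.cons_add, Int.toNat_of_nonneg hx.le]
      · simp only [Multiset.mem_cons, not_or]
        exact ⟨by omega, hA⟩
    · refine ⟨A, (-x).toNat ::ₘ B, ?_, hA, ?_⟩
      · rw [Multiset.map_cons, Multiset.add_cons, Int.toNat_of_nonneg (by omega), neg_neg]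
      · simp only [Multiset.mem_cons, not_or]
        exact ⟨by omega, hB⟩

theorem sum_map_add_map_neg (A B : Multiset ℕ) :
    (A.map (fun x : ℕ => (x : ℤ)) + B.map (fun x : ℕ => -(x : ℤ))).sum = (A.sum : ℤ) - B.sum := by
  rw [Multiset.sum_add, Multiset.sum_map_neg, ← sub_eq_add_neg, Nat.cast_multiset_sum,
    Nat.cast_multiset_sum]

theorem IsMinZeroSum.isPrimitivePartition {A B : Multiset ℕ} (hA : 0 ∉ A) (hB : 0 ∉ B)
    (h : IsMinZeroSum (A.map (fun x : ℕ => (x : ℤ)) + B.map (fun x : ℕ => -(x : ℤ)))) :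
    IsPrimitivePartition A B := by
  obtain ⟨h0, hmin⟩ := h
  rw [sum_map_add_map_neg] at h0
  refine ⟨hA, hB, by omega, fun X hX Y hY hXY => ?_⟩
  have hXA := Multiset.card_le_card hX
  have hYB := Multiset.card_le_card hY
  by_contra! hne
  refine hmin (X.map (fun x : ℕ => (x : ℤ)) + Y.map (fun x : ℕ => -(x : ℤ)))
    (add_le_add (Multiset.map_le_map hX) (Multiset.map_le_map hY)) (fun h => ?_) (fun h => ?_)
    (by rw [sum_map_add_map_neg, hXY, sub_self])
  · have hc := congrArg Multiset.card h
    simp only [Multiset.card_add, Multiset.card_map, Multiset.card_zero] at hc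
    exact hne.1 (Multiset.card_eq_zero.mp (by omega)) (Multiset.card_eq_zero.mp (by omega))
  · have hc := congrArg Multiset.card h
    simp only [Multiset.card_add, Multiset.card_map] at hc
    exact hne.2 (Multiset.eq_of_le_of_card_le hX (by omega))
      (Multiset.eq_of_le_of_card_le hY (by omega))

theorem isMinZeroSum_replicate_add_replicate {x y : ℕ} (hy : 0 < y)
    (hxy : x.Coprime y) :
    IsMinZeroSum (Multiset.replicate y (x : ℤ) + Multiset.replicate x (-y : ℤ)) := by
  refine ⟨by simp [mul_comm], fun T hT hT0 hTS hsum => ?_⟩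
  obtain ⟨i, hi, hi'⟩ := Multiset.le_replicate_iff.mp
    (Multiset.inter_le_right (s := T) (t := Multiset.replicate y (x : ℤ)))
  obtain ⟨j, hj, hj'⟩ := Multiset.le_replicate_iff.mp (tsub_le_iff_left.mpr hT)
  have hTij : T = Multiset.replicate i (x : ℤ) + Multiset.replicate j (-y : ℤ) := by
    rw [← hi', ← hj', add_comm, Multiset.sub_add_inter]
  subst hTij
  simp only [Multiset.sum_add, Multiset.sum_replicate, smul_neg, nsmul_eq_mul] at hsum
  have hij : i * x = j * y := by zify; linarith
  obtain ⟨c, rfl⟩ : y ∣ i := hxy.symm.dvd_of_dvd_mul_right ⟨j, by rw [hij, mul_comm]⟩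
  obtain rfl : c * x = j := Nat.eq_of_mul_eq_mul_right hy (by rw [← hij]; ring)
  have hc : c ≤ 1 := Nat.le_of_mul_le_mul_left (by simpa using hi) hy
  interval_cases c <;> simp at hT0 hTS

theorem rho_spec {m M : ℕ} (hm : 0 < m) (hM : 0 < M) : ∃ x y : ℕ, 0 < x ∧ 0 < y ∧ x ≤ M ∧
    y ≤ m ∧ x.Coprime y ∧ x + y + rho m M = m + M := by
  have h1 : M - 1 ∈ {t : ℕ | ∃ t' : ℕ, t' ≤ t ∧
      Int.gcd ((M : ℤ) - (t' : ℤ)) ((m : ℤ) - ((t - t' : ℕ) : ℤ)) = 1} :=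
    ⟨M - 1, le_rfl, by rw [Nat.cast_sub (by omega)]; simp⟩
  have h2 : m - 1 ∈ {t : ℕ | ∃ t' : ℕ, t' ≤ t ∧
      Int.gcd ((M : ℤ) - (t' : ℤ)) ((m : ℤ) - ((t - t' : ℕ) : ℤ)) = 1} :=
    ⟨0, Nat.zero_le _, by rw [Nat.cast_sub (by omega), Nat.cast_sub (by omega)]; simp⟩
  obtain ⟨t', ht', hg⟩ := Nat.sInf_mem ⟨_, h1⟩
  have h3 : rho m M ≤ M - 1 := Nat.sInf_le h1
  have h4 : rho m M ≤ m - 1 := Nat.sInf_le h2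
  change t' ≤ rho m M at ht'
  change Int.gcd _ ((m : ℤ) - ((rho m M - t' : ℕ) : ℤ)) = 1 at hg
  rw [← Nat.cast_sub (by omega), ← Nat.cast_sub (by omega), Int.gcd_natCast_natCast] at hg
  exact ⟨M - t', m - (rho m M - t'), by omega, by omega, by omega, by omega, hg, by omega⟩

theorem rho_le {m M i j t : ℕ} (hij : i + j ≤ t)
    (h : Int.gcd ((M : ℤ) - i) ((m : ℤ) - j) = 1) : rho m M ≤ t :=
  le_trans (Nat.sInf_le ⟨i, Nat.le_add_right i j, by rwa [Nat.add_sub_cancel_left]⟩) hij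

theorem IsMinZeroSum.card_add_rho_le {m M : ℕ} (hm : 0 < m) (hM : 0 < M) {S : Multiset ℤ}
    (h : IsMinZeroSum S) (hS : ∀ x ∈ S, -(m : ℤ) ≤ x ∧ x ≤ M) : S.card + rho m M ≤ m + M := by
  obtain ⟨x, y, hx, hy, -, -, -, hxy⟩ := rho_spec hm hM
  by_cases hcard : S.card ≤ 1
  · omega
  have h0 : 0 ∉ S := fun h0 => h.2 {0} (Multiset.singleton_le.mpr h0) (by simp)
    (by rintro rfl; simp at hcard) (by simp)
  obtain ⟨A, B, rfl, hA, hB⟩ := exists_eq_map_add_map_neg S h0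
  have hP := h.isPrimitivePartition hA hB
  rw [Multiset.card_add, Multiset.card_map, Multiset.card_map] at hcard ⊢
  have hApos : 0 < A.card := by
    by_contra hA0
    have := hP.symm.sum_pos (by omega)
    have hA0 := Multiset.card_eq_zero.mp (Nat.eq_zero_of_not_pos hA0)
    rw [← hP.2.2.1, hA0] at this
    exact lt_irrefl _ this
  have hBpos : 0 < B.card := by
    by_contra hB0
    have := hP.sum_pos hApos
    have hB0 := Multiset.card_eq_zero.mp (Nat.eq_zero_of_not_pos hB0)
    rw [hP.2.2.1, hB0] at this
    exact lt_irrefl _ this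
  have hAM : ∀ x ∈ A, x ≤ M := fun x hx => by
    have := (hS x (Multiset.mem_add.mpr (.inl (Multiset.mem_map_of_mem _ hx)))).2
    omega
  have hBm : ∀ x ∈ B, x ≤ m := fun x hx => by
    have := (hS (-x) (Multiset.mem_add.mpr (.inr
      (Multiset.mem_map_of_mem (fun x : ℕ => -(x : ℤ)) hx)))).1
    omega
  have h1 := hP.card_right_le hApos hAM
  have h2 := hP.symm.card_right_le hBpos hBm
  obtain ⟨i, j, hij, hg⟩ := hP.exists_gcd_eq_one (t := m + M - (A.card + B.card)) hApos hBpos hAM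
    hBm (by omega) hm hM
  have := rho_le hij hg
  omega

theorem stmt_0 (m M : ℕ) (hm : 0 < m) (hM : 0 < M) :
    (davenport m M : ℤ) = (m : ℤ) + (M : ℤ) - (rho m M : ℤ) := by
  obtain ⟨x, y, hx, hy, hxM, hym, hco, hxy⟩ := rho_spec hm hM
  have hgreatest : IsGreatest {n : ℕ | ∃ S : Multiset ℤ, IsMinZeroSum S ∧
      (∀ x ∈ S, -(m : ℤ) ≤ x ∧ x ≤ (M : ℤ)) ∧ S.card = n} (x + y) := by
    refine ⟨⟨_, isMinZeroSum_replicate_add_replicate hy hco, fun z hz => ?_, ?_⟩, ?_⟩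
    · rcases Multiset.mem_add.mp hz with hz | hz <;>
        rw [Multiset.eq_of_mem_replicate hz] <;> omega
    · rw [Multiset.card_add, Multiset.card_replicate, Multiset.card_replicate, add_comm]
    · rintro _ ⟨S, hS, hSm, rfl⟩
      have := hS.card_add_rho_le hm hM hSm
      omega
  have : davenport m M = x + y := hgreatest.csSup_eq
  omega
end

section
/- Let m and M be positive integers. Then χ(⟦-m,M⟧) = m + M - ρ(m,M). -/
noncomputable def chi (m M : ℕ) : ℤ :=
  sSup {z : ℤ | ∃ x y : ℤ, (-(m : ℤ) ≤ x ∧ x ≤ (M : ℤ)) ∧ (-(m : ℤ) ≤ y ∧ y ≤ (M : ℤ)) ∧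
    x * y < 0 ∧ z = (|x| + |y|) / (Int.gcd x y : ℤ)}

theorem rho_le_of_coprime {m M a b : ℕ} (ha : a ≤ M) (hb : b ≤ m) (h : Nat.Coprime a b) :
    rho m M ≤ (M - a) + (m - b) := by
  refine Nat.sInf_le ⟨M - a, by omega, ?_⟩
  have h1 : (M : ℤ) - ((M - a : ℕ) : ℤ) = a := by omega
  have h2 : (m : ℤ) - (((M - a) + (m - b) - (M - a) : ℕ) : ℤ) = b := by omega
  rw [h1, h2, Int.gcd_natCast_natCast]
  exact h

theorem exists_coprime_rho_eq {m M : ℕ} (hm : 0 < m) (hM : 0 < M) :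
    ∃ a b : ℕ, 0 < a ∧ a ≤ M ∧ 0 < b ∧ b ≤ m ∧ Nat.Coprime a b ∧
      (a : ℤ) + b = m + M - rho m M := by
  have hne : {t : ℕ | ∃ t' : ℕ, t' ≤ t ∧
      Int.gcd ((M : ℤ) - (t' : ℤ)) ((m : ℤ) - ((t - t' : ℕ) : ℤ)) = 1}.Nonempty := by
    refine ⟨(M - 1) + (m - 1), M - 1, by omega, ?_⟩
    have h1 : (M : ℤ) - ((M - 1 : ℕ) : ℤ) = 1 := by omega
    rw [h1, Int.one_gcd]
  obtain ⟨t', ht', hg⟩ := Nat.sInf_mem hne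
  change t' ≤ rho m M at ht'
  change Int.gcd ((M : ℤ) - (t' : ℤ)) ((m : ℤ) - ((rho m M - t' : ℕ) : ℤ)) = 1 at hg
  have h11 := rho_le_of_coprime (m := m) (M := M) (a := 1) (b := 1) hM hm (by simp)
  have h1 : t' < M := by
    by_contra! hlt
    have := rho_le_of_coprime (m := m) (M := M) (a := 1) (b := m - (rho m M - t'))
      hM (by omega) (by simp)
    omega
  have h2 : rho m M - t' < m := by
    by_contra! hlt
    have := rho_le_of_coprime (m := m) (M := M) (a := M - t') (b := 1)
      (by omega) hm (by simp)
    omega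
  refine ⟨M - t', m - (rho m M - t'), by omega, by omega, by omega, by omega, ?_, by omega⟩
  rw [← Nat.cast_sub h1.le, ← Nat.cast_sub h2.le, Int.gcd_natCast_natCast] at hg
  exact hg

theorem add_div_gcd_le {m M a b : ℕ} (ha : 0 < a) (haM : a ≤ M) (hbm : b ≤ m) :
    ((a : ℤ) + b) / (Nat.gcd a b : ℤ) ≤ m + M - rho m M := by
  obtain ⟨g, a', b', hg, hco, rfl, rfl⟩ := Nat.exists_coprime' (Nat.gcd_pos_of_pos_left b ha)
  have hgcd : Nat.gcd (a' * g) (b' * g) = g := by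
    rw [Nat.gcd_mul_right, hco.gcd_eq_one, one_mul]
  have h1 : a' ≤ M := (Nat.le_mul_of_pos_right a' hg).trans haM
  have h2 : b' ≤ m := (Nat.le_mul_of_pos_right b' hg).trans hbm
  have h := rho_le_of_coprime h1 h2 hco
  rw [hgcd]
  push_cast
  rw [← add_mul, Int.mul_ediv_cancel _ (by omega)]
  omega

theorem stmt_2 (m M : ℕ) (hm : 0 < m) (hM : 0 < M) :
    chi m M = (m : ℤ) + (M : ℤ) - (rho m M : ℤ) := by
  refine IsGreatest.csSup_eq ⟨?_, ?_⟩
  · obtain ⟨a, b, ha, haM, hb, hbm, hco, hsum⟩ := exists_coprime_rho_eq hm hM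
    refine ⟨a, -b, by omega, by omega, ?_, ?_⟩
    · have : (0 : ℤ) < a * b := by positivity
      linarith
    · rw [Int.gcd_neg, Int.gcd_natCast_natCast, hco.gcd_eq_one]
      simp [hsum]
  · rintro z ⟨x, y, hx, hy, hxy, rfl⟩
    rw [Int.gcd_eq_natAbs_gcd_natAbs, Int.abs_eq_natAbs, Int.abs_eq_natAbs]
    rcases mul_neg_iff.1 hxy with ⟨h1, h2⟩ | ⟨h1, h2⟩
    · exact add_div_gcd_le (by omega) (by omega) (by omega)
    · rw [add_comm, Nat.gcd_comm]
      exact add_div_gcd_le (by omega) (by omega) (by omega)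
end

section
/- Let m and M be positive integers. Then D(⟦-m,M⟧) ≥ m + M - ρ(m,M). -/
theorem isMinZeroSum_replicate {A B : ℕ} (hB : 0 < B) (h : Nat.Coprime A B) :
    IsMinZeroSum (Multiset.replicate B (A : ℤ) + Multiset.replicate A (-(B : ℤ))) := by
  refine ⟨by simp [mul_comm], fun T hT h0 hne hsum => ?_⟩
  set s := Multiset.replicate B (A : ℤ) with hs
  obtain ⟨i, hi, hTi⟩ := Multiset.le_replicate_iff.mp (Multiset.inter_le_right : T ∩ s ≤ s)
  obtain ⟨j, hj, hTj⟩ := Multiset.le_replicate_iff.mp (tsub_le_iff_left.mpr hT)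
  have hdecomp := Multiset.sub_add_inter T s
  rw [hTi, hTj] at hdecomp
  have hij : i * A = j * B := by
    rw [← hdecomp] at hsum
    simp only [Multiset.sum_add, Multiset.sum_replicate, nsmul_eq_mul] at hsum
    zify
    linarith
  obtain ⟨k, rfl⟩ : B ∣ i := h.symm.dvd_of_dvd_mul_right ⟨j, by rw [hij, mul_comm]⟩
  have hk : k ≤ 1 := by
    by_contra! hk
    nlinarith
  obtain rfl : j = k * A := by
    apply Nat.eq_of_mul_eq_mul_right hB
    rw [← hij]
    ring
  interval_cases k
  · simp only [mul_zero, zero_mul, Multiset.replicate_zero, add_zero] at hdecomp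
    exact h0 hdecomp.symm
  · apply hne
    rw [← hdecomp, add_comm, hs]
    simp

theorem finite_setOf_isMinZeroSum (m M : ℕ) :
    {S : Multiset ℤ | IsMinZeroSum S ∧ ∀ x ∈ S, -(m : ℤ) ≤ x ∧ x ≤ (M : ℤ)}.Finite := by
  set P := {S : Multiset ℤ | IsMinZeroSum S ∧ ∀ x ∈ S, -(m : ℤ) ≤ x ∧ x ≤ (M : ℤ)}
  let f : Multiset ℤ → (Finset.Icc (-(m : ℤ)) M → ℕ) := fun S x => S.count (x : ℤ)
  have hle : ∀ S ∈ P, ∀ T, f S ≤ f T → S ≤ T := by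
    intro S hS T h
    rw [Multiset.le_iff_count]
    intro x
    by_cases hx : x ∈ S
    · exact h ⟨x, Finset.mem_Icc.mpr (hS.2 x hx)⟩
    · simp [Multiset.count_eq_zero_of_notMem hx]
  have hinj : Set.InjOn f P := fun S hS T hT h =>
    le_antisymm (hle S hS T h.le) (hle T hT S h.ge)
  have hanti : IsAntichain (· ≤ ·) (f '' (P \ {0})) := by
    rintro _ ⟨S, hS, rfl⟩ _ ⟨T, hT, rfl⟩ hne h
    exact hT.1.1.2 S (hle S hS.1 T h) hS.2 (fun e => hne (e ▸ rfl)) hS.1.1.1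
  have hfin : (P \ {0}).Finite :=
    (hanti.finite_of_partiallyWellOrderedOn (Set.isPWO_of_wellQuasiOrderedLE _)).of_finite_image
      (hinj.mono Set.sdiff_subset)
  exact (hfin.union (Set.finite_singleton 0)).subset (by simp)

theorem card_le_davenport {m M : ℕ} {S : Multiset ℤ} (hS : IsMinZeroSum S)
    (hmem : ∀ x ∈ S, -(m : ℤ) ≤ x ∧ x ≤ (M : ℤ)) : S.card ≤ davenport m M := by
  refine le_csSup (((finite_setOf_isMinZeroSum m M).image Multiset.card).subset ?_).bddAbove
    ⟨S, hS, hmem, rfl⟩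
  rintro _ ⟨T, hT, hTmem, rfl⟩
  exact ⟨T, ⟨hT, hTmem⟩, rfl⟩

theorem exists_rho_eq_add {m M : ℕ} (hm : 0 < m) (hM : 0 < M) :
    ∃ a b : ℕ, rho m M = a + b ∧ a < M ∧ b < m ∧ Nat.Coprime (M - a) (m - b) := by
  have hleM : rho m M ≤ M - 1 := Nat.sInf_le ⟨M - 1, le_rfl, by simp [Nat.cast_sub hM]⟩
  have hlem : rho m M ≤ m - 1 := Nat.sInf_le ⟨0, by simp, by simp [Nat.cast_sub hm]⟩
  obtain ⟨a, ha, hgcd⟩ : ∃ a ≤ rho m M,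
      Int.gcd ((M : ℤ) - (a : ℤ)) ((m : ℤ) - ((rho m M - a : ℕ) : ℤ)) = 1 :=
    Nat.sInf_mem (s := {t : ℕ | ∃ t' : ℕ, t' ≤ t ∧
      Int.gcd ((M : ℤ) - (t' : ℤ)) ((m : ℤ) - ((t - t' : ℕ) : ℤ)) = 1})
      ⟨M - 1, M - 1, le_rfl, by simp [Nat.cast_sub hM]⟩
  refine ⟨a, rho m M - a, by omega, by omega, by omega, ?_⟩
  rwa [← Nat.cast_sub (by omega), ← Nat.cast_sub (by omega), Int.gcd_natCast_natCast] at hgcd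

theorem stmt_3 (m M : ℕ) (hm : 0 < m) (hM : 0 < M) :
    (m : ℤ) + (M : ℤ) - (rho m M : ℤ) ≤ (davenport m M : ℤ) := by
  obtain ⟨a, b, hrho, ha, hb, hcop⟩ := exists_rho_eq_add hm hM
  have hcard := card_le_davenport (m := m) (M := M)
    (isMinZeroSum_replicate (Nat.sub_pos_of_lt hb) hcop) (by
      intro x hx
      rcases Multiset.mem_add.mp hx with hx | hx <;>
        rw [Multiset.eq_of_mem_replicate hx] <;> omega)
  rw [Multiset.card_add, Multiset.card_replicate, Multiset.card_replicate] at hcard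
  omega
end

section
/- Let S be a minimal zero-sum multiset of integers, let a be an element of S, and let d be the greatest common divisor of the elements of S with one copy of a removed. Then d divides a, and the multiset obtained from S by dividing each element by d is again a minimal zero-sum multiset of integers. -/
/-- Dividing every element of a minimal zero-sum multiset by a common divisor
yields a minimal zero-sum multiset. -/
theorem IsMinZeroSum.map_ediv {S : Multiset ℤ} (hS : IsMinZeroSum S) {d : ℤ}
    (h : ∀ x ∈ S, d ∣ x) : IsMinZeroSum (S.map (fun x => x / d)) := by
  have hmap : (S.map (fun x => x / d)).map (fun x => d * x) = S := by
    rw [Multiset.map_map]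
    conv_rhs => rw [← Multiset.map_id' S]
    exact Multiset.map_congr rfl fun x hx => Int.mul_ediv_cancel' (h x hx)
  refine ⟨?_, fun T hT hT0 hTS hsum => ?_⟩
  · rcases eq_or_ne d 0 with rfl | hd
    · simp
    · have hmul : d * (S.map (fun x => x / d)).sum = 0 := by
        rw [← Multiset.map_id' (S.map _), ← Multiset.sum_map_mul_left, hmap, hS.1]
      exact (mul_eq_zero.mp hmul).resolve_left hd
  · refine hS.2 (T.map (fun x => d * x)) ?_ ?_ ?_ ?_
    · exact (Multiset.map_le_map hT).trans_eq hmap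
    · simpa using hT0
    · intro hTeq
      refine hTS (Multiset.eq_of_le_of_card_le hT ?_)
      rw [Multiset.card_map, ← hTeq, Multiset.card_map]
    · rw [Multiset.sum_map_mul_left, Multiset.map_id', hsum, mul_zero]

theorem stmt_4 (S : Multiset ℤ) (hS : IsMinZeroSum S) (a : ℤ) (ha : a ∈ S)
    (d : ℤ) (hd : d = (S.erase a).gcd) :
    d ∣ a ∧ IsMinZeroSum (S.map (fun x => x / d)) := by
  have herase : ∀ x ∈ S.erase a, d ∣ x := fun x hx => hd ▸ Multiset.gcd_dvd hx
  have hda : d ∣ a := by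
    have hsum : a + (S.erase a).sum = 0 := by
      rw [← Multiset.sum_cons, Multiset.cons_erase ha, hS.1]
    exact (dvd_add_left (Multiset.dvd_sum herase)).mp (hsum ▸ dvd_zero d)
  refine ⟨hda, hS.map_ediv fun x hx => ?_⟩
  rcases eq_or_ne x a with rfl | hxa
  · exact hda
  · exact herase x ((Multiset.mem_erase_of_ne hxa).mpr hx)
end

section
/- Let S be a minimal zero-sum multiset of integers with at least two elements, let a be an element of S, and let d be the greatest common divisor of the elements of S with one copy of a removed. Then the cardinality of S is at most (max S - min S)/d, where max S and min S denote the largest and smallest elements of S. -/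
theorem Multiset.exists_neg_of_sum_neg {R : Multiset ℤ} (h : R.sum < 0) : ∃ x ∈ R, x < 0 := by
  by_contra! hR
  exact absurd (Multiset.sum_nonneg hR) (not_le.mpr h)

theorem Multiset.exists_nonneg_of_sum_nonneg {R : Multiset ℤ} (hR : R ≠ 0) (h : 0 ≤ R.sum) :
    ∃ x ∈ R, 0 ≤ x := by
  induction R using Multiset.induction with
  | empty => exact absurd rfl hR
  | cons y R ih =>
    by_cases hy : 0 ≤ y
    · exact ⟨y, Multiset.mem_cons_self y R, hy⟩
    · rw [Multiset.sum_cons] at h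
      have hR' : R ≠ 0 := by
        rintro rfl
        simp at h
        exact hy h
      obtain ⟨x, hx, hx0⟩ := ih hR' (by linarith)
      exact ⟨x, Multiset.mem_cons_of_mem hx, hx0⟩

/-- A multiset of integers in `[b, B]` can be ordered so that the partial sums, starting from `s`
and ending at `0`, all stay in `(b, B]`. -/
theorem Multiset.exists_list_partial_sums_mem_Ioc {b B : ℤ} (n : ℕ) (R : Multiset ℤ) (s : ℤ)
    (hn : R.card = n) (hsum : s + R.sum = 0) (hs : s ∈ Set.Ioc b B)
    (hR : ∀ x ∈ R, x ∈ Set.Icc b B) :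
    ∃ l : List ℤ, (l : Multiset ℤ) = R ∧ ∀ k, s + (l.take k).sum ∈ Set.Ioc b B := by
  induction n generalizing R s with
  | zero =>
    refine ⟨[], ?_, by simpa using hs⟩
    rw [Multiset.card_eq_zero.mp hn]
    rfl
  | succ n ih =>
    have hR0 : R ≠ 0 := by
      rintro rfl
      simp at hn
    obtain ⟨x, hx, hsx⟩ : ∃ x ∈ R, s + x ∈ Set.Ioc b B := by
      obtain ⟨hs₁, hs₂⟩ := hs
      rcases le_or_gt s 0 with h | h
      · obtain ⟨x, hx, hx0⟩ := Multiset.exists_nonneg_of_sum_nonneg hR0 (by linarith)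
        obtain ⟨_, _⟩ := hR x hx
        exact ⟨x, hx, by constructor <;> linarith⟩
      · obtain ⟨x, hx, hx0⟩ := Multiset.exists_neg_of_sum_neg (R := R) (by linarith)
        obtain ⟨_, _⟩ := hR x hx
        exact ⟨x, hx, by constructor <;> linarith⟩
    have hcons := Multiset.cons_erase hx
    obtain ⟨l, hl, hk⟩ := ih (R.erase x) (s + x)
      (by rw [Multiset.card_erase_of_mem hx, hn]; rfl)
      (by rw [← hcons, Multiset.sum_cons] at hsum; linarith) hsx
      (fun y hy => hR y (Multiset.mem_of_mem_erase hy))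
    refine ⟨x :: l, by rw [← Multiset.cons_coe, hl, hcons], fun k => ?_⟩
    cases k with
    | zero => simpa using hs
    | succ k => simpa [add_assoc] using hk k

theorem IsMinZeroSum.zero_notMem {S : Multiset ℤ} (hS : IsMinZeroSum S) (hcard : 2 ≤ S.card) :
    (0 : ℤ) ∉ S := by
  intro h
  refine hS.2 {0} (Multiset.singleton_le.mpr h) (by simp) ?_ (by simp)
  rintro rfl
  simp at hcard

theorem IsMinZeroSum.sum_take_injOn {l : List ℤ} (hl : IsMinZeroSum (l : Multiset ℤ)) :
    Set.InjOn (fun k => (l.take k).sum) (Finset.range l.length) := by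
  have key : ∀ i j, i < j → j < l.length → (l.take i).sum ≠ (l.take j).sum := by
    intro i j hij hj h
    have hlen : ((l.take j).drop i).length = j - i := by
      rw [List.length_drop, List.length_take]
      omega
    have hsub : ((l.take j).drop i).Sublist l :=
      (List.drop_sublist _ _).trans (List.take_sublist _ _)
    refine hl.2 ((l.take j).drop i : List ℤ) (Multiset.coe_le.mpr hsub.subperm) ?_ ?_ ?_
    · intro h0
      have := congrArg Multiset.card h0
      rw [Multiset.coe_card, Multiset.card_zero] at this
      omega
    · intro h0
      have := congrArg Multiset.card h0
      rw [Multiset.coe_card, Multiset.coe_card] at this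
      omega
    · have h1 := List.sum_take_add_sum_drop (l.take j) i
      rw [List.take_take, min_eq_left hij.le] at h1
      rw [Multiset.sum_coe]
      linarith
  intro i hi j hj h
  simp only [Finset.coe_range, Set.mem_Iio] at hi hj
  rcases lt_trichotomy i j with hij | hij | hij
  · exact absurd h (key i j hij hj)
  · exact hij
  · exact absurd h.symm (key j i hij hi)

theorem stmt_5 (S : Multiset ℤ) (hS : IsMinZeroSum S) (hcard : 2 ≤ S.card)
    (a : ℤ) (ha : a ∈ S) (d : ℤ) (hd : d = (S.erase a).gcd)
    (B b : ℤ) (hB : B ∈ S) (hBmax : ∀ x ∈ S, x ≤ B)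
    (hb : b ∈ S) (hbmin : ∀ x ∈ S, b ≤ x) :
    (S.card : ℤ) ≤ (B - b) / d := by
  have h0 := hS.zero_notMem hcard
  have hdvd_erase : ∀ x ∈ S.erase a, d ∣ x := fun x hx => hd ▸ Multiset.gcd_dvd hx
  have hdvd : ∀ x ∈ S, d ∣ x := by
    intro x hx
    rw [← Multiset.cons_erase ha, Multiset.mem_cons] at hx
    rcases hx with rfl | hx
    · have hsum := hS.1
      rw [← Multiset.cons_erase ha, Multiset.sum_cons] at hsum
      rw [eq_neg_of_add_eq_zero_left hsum, dvd_neg]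
      exact Multiset.dvd_sum hdvd_erase
    · exact hdvd_erase x hx
  have hdpos : 0 < d := by
    refine lt_of_le_of_ne ?_ ?_
    · rw [hd]
      exact Int.nonneg_of_normalize_eq_self (Multiset.normalize_gcd _)
    · rintro rfl
      exact h0 (zero_dvd_iff.mp (hdvd b hb) ▸ hb)
  have hS0 : S ≠ 0 := by
    rintro rfl
    simp at hb
  have hB0 : 0 ≤ B := by
    obtain ⟨x, hx, hx0⟩ := Multiset.exists_nonneg_of_sum_nonneg hS0 hS.1.ge
    exact hx0.trans (hBmax x hx)
  have hb0 : b < 0 := by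
    by_contra! h
    have hle := Multiset.single_le_sum (fun x hx => h.trans (hbmin x hx)) b hb
    rw [hS.1] at hle
    exact h0 (le_antisymm hle h ▸ hb)
  obtain ⟨l, rfl, hl⟩ := Multiset.exists_list_partial_sums_mem_Ioc S.card S 0 rfl
    (by rw [zero_add, hS.1]) ⟨hb0, hB0⟩ (fun x hx => ⟨hbmin x hx, hBmax x hx⟩)
  have hdiv : ∀ k, d ∣ (l.take k).sum := fun k =>
    List.dvd_sum fun x hx => hdvd x (List.mem_of_mem_take hx)
  obtain ⟨b', rfl⟩ := hdvd b hb
  obtain ⟨B', rfl⟩ := hdvd B hB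
  choose q hq using hdiv
  rw [← mul_sub, Int.mul_ediv_cancel_left _ hdpos.ne', Multiset.coe_card]
  have hle : (Finset.range l.length).card ≤ (Finset.Ioc b' B').card := by
    refine Finset.card_le_card_of_injOn q (fun k _ => ?_) fun i hi j hj hij => ?_
    · have hk := hl k
      rw [zero_add, hq k] at hk
      rw [Finset.coe_Ioc]
      exact ⟨lt_of_mul_lt_mul_left hk.1 hdpos.le, le_of_mul_le_mul_left hk.2 hdpos⟩
    · refine hS.sum_take_injOn hi hj ?_
      change (l.take i).sum = (l.take j).sum
      rw [hq i, hq j, hij]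
  have hlt : b' < B' := by
    refine lt_of_mul_lt_mul_left ?_ hdpos.le
    linarith
  rw [Finset.card_range, Int.card_Ioc] at hle
  omega
end

section
/- Let m and M be positive integers and let S be a minimal zero-sum multiset whose elements all lie in ⟦-m,M⟧ and which contains at least one element distinct from both -m and M. Then there exists a list l whose underlying multiset is S such that every nonempty prefix of l has its sum in ⟦-(m-1), M-1⟧; in particular, the cardinality of S is at most m + M - 1. -/
/-- A greedy ordering: starting from `s`, the elements of `R` can be added one at a time with all
intermediate sums staying in `[-(m - 1), M - 1]`, as long as the sum cannot vanish too early. -/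
theorem exists_list_forall_take_sum_mem_Icc {m M : ℤ} (R : Multiset ℤ) (s : ℤ)
    (hs : s ∈ Set.Icc (-(m - 1)) (M - 1)) (hsum : s + R.sum = 0)
    (hmem : ∀ x ∈ R, x ∈ Set.Icc (-m) M)
    (hmin : ∀ T ≤ R, T ≠ R → s + T.sum ≠ 0) :
    ∃ l : List ℤ, (l : Multiset ℤ) = R ∧
      ∀ k, s + (l.take k).sum ∈ Set.Icc (-(m - 1)) (M - 1) := by
  induction hn : R.card generalizing R s with
  | zero =>
    obtain rfl := Multiset.card_eq_zero.mp hn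
    exact ⟨[], rfl, by simpa using hs⟩
  | succ n ih =>
    have hR : R ≠ 0 := by
      rintro rfl
      simp at hn
    have hs0 : s ≠ 0 := by simpa using hmin 0 (Multiset.zero_le R) hR.symm
    have hstep : ∃ a ∈ R, s + a ∈ Set.Icc (-(m - 1)) (M - 1) := by
      simp only [Set.mem_Icc] at hs hmem ⊢
      rcases lt_or_gt_of_ne hs0 with hneg | hpos
      · have ha : ∃ a ∈ R, 0 < a := by
          by_contra! h
          have := Multiset.sum_nonneg (s := R.map Neg.neg) (by simpa using h)
          rw [Multiset.sum_map_neg'] at this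
          omega
        obtain ⟨a, haR, ha⟩ := ha
        have := hmem a haR
        exact ⟨a, haR, by omega, by omega⟩
      · have ha : ∃ a ∈ R, a < 0 := by
          by_contra! h
          have := Multiset.sum_nonneg h
          omega
        obtain ⟨a, haR, ha⟩ := ha
        have := hmem a haR
        exact ⟨a, haR, by omega, by omega⟩
    obtain ⟨a, haR, ha⟩ := hstep
    obtain ⟨R, rfl⟩ := Multiset.exists_cons_of_mem haR
    obtain ⟨l, rfl, hl⟩ := ih R (s + a) ha (by simpa [add_assoc] using hsum)
      (fun x hx ↦ hmem x (Multiset.mem_cons_of_mem hx))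
      (fun T hT hne ↦ by
        simpa [add_assoc] using hmin (a ::ₘ T) (Multiset.cons_le_cons a hT) (by simpa using hne))
      (by simpa using hn)
    refine ⟨a :: l, rfl, fun k ↦ ?_⟩
    cases k with
    | zero => simpa using hs
    | succ k => simpa [add_assoc] using hl k

/-- The nonempty prefixes of an ordering of a minimal zero-sum multiset have distinct sums. -/
theorem IsMinZeroSum.injOn_take_sum {l : List ℤ} (hl : IsMinZeroSum (l : Multiset ℤ)) :
    Set.InjOn (fun k ↦ (l.take k).sum) (Finset.Icc 1 l.length : Finset ℕ) := by
  have key : ∀ i j, 1 ≤ i → i < j → j ≤ l.length → (l.take i).sum ≠ (l.take j).sum := by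
    intro i j hi hij hj heq
    have hlen : ((l.take j).drop i).length = j - i := by
      simp [hj]
    refine hl.2 ((l.take j).drop i : List ℤ) ?_ ?_ ?_ ?_
    · exact Multiset.coe_le.mpr
        ((List.drop_sublist _ _).trans (List.take_sublist _ _)).subperm
    · intro h
      have := congrArg Multiset.card h
      rw [Multiset.coe_card, hlen, Multiset.card_zero] at this
      omega
    · intro h
      have := congrArg Multiset.card h
      rw [Multiset.coe_card, hlen, Multiset.coe_card] at this
      omega
    · have := List.sum_take_add_sum_drop (l.take j) i
      rw [List.take_take, min_eq_left hij.le] at this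
      rw [Multiset.sum_coe]
      omega
  intro i hi j hj heq
  simp only [Finset.coe_Icc, Set.mem_Icc] at hi hj
  rcases lt_trichotomy i j with h | h | h
  · exact absurd heq (key i j hi.1 h hj.2)
  · exact h
  · exact absurd heq.symm (key j i hj.1 h hi.2)

theorem stmt_6 (m M : ℕ) (hm : 0 < m) (hM : 0 < M) (S : Multiset ℤ)
    (hS : IsMinZeroSum S) (hmem : ∀ x ∈ S, -(m : ℤ) ≤ x ∧ x ≤ (M : ℤ))
    (hex : ∃ x ∈ S, x ≠ -(m : ℤ) ∧ x ≠ (M : ℤ)) :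
    (∃ l : List ℤ, (l : Multiset ℤ) = S ∧ ∀ k, 0 < k → k ≤ l.length →
      -((m : ℤ) - 1) ≤ (l.take k).sum ∧ (l.take k).sum ≤ (M : ℤ) - 1) ∧
    (S.card : ℤ) ≤ (m : ℤ) + (M : ℤ) - 1 := by
  have hlist : ∃ l : List ℤ, (l : Multiset ℤ) = S ∧ ∀ k, 0 < k → k ≤ l.length →
      -((m : ℤ) - 1) ≤ (l.take k).sum ∧ (l.take k).sum ≤ (M : ℤ) - 1 := by
    obtain ⟨x, hxS, hxm, hxM⟩ := hex
    have hx := hmem x hxS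
    obtain ⟨R, rfl⟩ := Multiset.exists_cons_of_mem hxS
    obtain ⟨l, rfl, hl⟩ := exists_list_forall_take_sum_mem_Icc (m := m) (M := M) R x
      ⟨by omega, by omega⟩ (by simpa using hS.1)
      (fun y hy ↦ hmem y (Multiset.mem_cons_of_mem hy))
      (fun T hT hne ↦ by
        simpa using hS.2 (x ::ₘ T) (Multiset.cons_le_cons x hT) (Multiset.cons_ne_zero)
          (by simpa using hne))
    refine ⟨x :: l, rfl, fun k hk _ ↦ ?_⟩
    obtain ⟨k, rfl⟩ := Nat.exists_eq_succ_of_ne_zero hk.ne'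
    simpa using hl k
  refine ⟨hlist, ?_⟩
  obtain ⟨l, rfl, hl⟩ := hlist
  have hcard := Finset.card_le_card_of_injOn (s := Finset.Icc 1 l.length)
    (t := Finset.Icc (-((m : ℤ) - 1)) ((M : ℤ) - 1)) (fun k ↦ (l.take k).sum)
    (fun k hk ↦ by
      have hk := Finset.mem_Icc.mp hk
      exact Finset.mem_coe.mpr (Finset.mem_Icc.mpr (hl k hk.1 hk.2)))
    hS.injOn_take_sum
  rw [Nat.card_Icc, Int.card_Icc] at hcard
  rw [Multiset.coe_card]
  omega
end

section
/- Let m and M be positive integers with ρ(m,M) = 0 (equivalently, gcd(m,M) = 1). Then D(⟦-m,M⟧) = m + M. -/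
theorem coprime_of_rho_eq_zero {m M : ℕ} (hM : 0 < M) (h : rho m M = 0) :
    Nat.Coprime M m := by
  rcases Nat.sInf_eq_zero.mp h with ⟨t', ht', hg⟩ | hempty
  · obtain rfl : t' = 0 := by omega
    simpa using hg
  · exfalso
    refine Set.eq_empty_iff_forall_notMem.mp hempty (M - 1 + m) ⟨M - 1, by omega, ?_⟩
    have h₁ : (M : ℤ) - ((M - 1 : ℕ) : ℤ) = 1 := by omega
    simp [h₁]

/-- A zero-sum sequence over `⟦-m,M⟧` can be ordered so that its partial sums lie in
`⟦1-m,M⟧`. -/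
theorem exists_list_partial_sums_mem_Icc {m M : ℤ} (R : Multiset ℤ) :
    ∀ s ∈ Finset.Icc (1 - m) M, s + R.sum = 0 → (∀ x ∈ R, -m ≤ x ∧ x ≤ M) →
      ∃ l : List ℤ, (l : Multiset ℤ) = R ∧
        ∀ k, s + (l.take k).sum ∈ Finset.Icc (1 - m) M := by
  induction hn : R.card generalizing R with
  | zero =>
    intro s hs _ _
    obtain rfl := Multiset.card_eq_zero.mp hn
    exact ⟨[], rfl, fun k => by simpa using hs⟩
  | succ n ih =>
    intro s hs hsum hR
    rw [Finset.mem_Icc] at hs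
    have hR0 : R ≠ 0 := by
      rintro rfl
      simp at hn
    obtain ⟨x, hx, hsx⟩ : ∃ x ∈ R, s + x ∈ Finset.Icc (1 - m) M := by
      simp only [Finset.mem_Icc]
      rcases le_or_gt s 0 with hs0 | hs0
      · obtain ⟨x, hx, hx0⟩ : ∃ x ∈ R, 0 ≤ x := by
          by_contra! hneg
          have := Multiset.sum_lt_sum_of_nonempty (f := id) (g := fun _ => (0 : ℤ)) hR0 hneg
          simp at this
          omega
        have := hR x hx
        exact ⟨x, hx, by omega, by omega⟩
      · obtain ⟨x, hx, hx0⟩ : ∃ x ∈ R, x < 0 := by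
          by_contra! hpos
          have := Multiset.sum_nonneg hpos
          omega
        have := hR x hx
        exact ⟨x, hx, by omega, by omega⟩
    obtain ⟨R, rfl⟩ := Multiset.exists_cons_of_mem hx
    simp only [Multiset.card_cons, Nat.add_right_cancel_iff] at hn
    rw [Multiset.sum_cons] at hsum
    obtain ⟨l, rfl, hl⟩ := ih R hn (s + x) hsx (by omega)
      fun y hy => hR y (Multiset.mem_cons_of_mem hy)
    refine ⟨x :: l, rfl, fun k => ?_⟩
    cases k with
    | zero => simpa using hs
    | succ k => simpa [add_assoc] using hl k

theorem IsMinZeroSum.card_le {m M : ℕ} (hm : 0 < m) {S : Multiset ℤ} (hS : IsMinZeroSum S)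
    (hb : ∀ x ∈ S, -(m : ℤ) ≤ x ∧ x ≤ (M : ℤ)) : S.card ≤ m + M := by
  obtain ⟨l, rfl, hl⟩ := exists_list_partial_sums_mem_Icc S 0
    (Finset.mem_Icc.mpr ⟨by omega, by omega⟩) (by rw [hS.1, add_zero]) hb
  have hne : ∀ i j, i < j → j < l.length → (l.take i).sum ≠ (l.take j).sum := by
    intro i j hij hj heq
    have hsub : ((l.take j).drop i).Sublist l :=
      (List.drop_sublist _ _).trans (List.take_sublist _ _)
    have hlen : ((l.take j).drop i).length = j - i := by
      rw [List.length_drop, List.length_take, min_eq_left hj.le]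
    refine hS.2 ((l.take j).drop i : List ℤ) (Multiset.coe_le.mpr hsub.subperm) ?_ ?_ ?_
    · intro h0
      have := congrArg Multiset.card h0
      simp only [Multiset.coe_card, Multiset.card_zero, hlen] at this
      omega
    · intro h0
      have := congrArg Multiset.card h0
      simp only [Multiset.coe_card, hlen] at this
      omega
    · have := List.sum_take_add_sum_drop (l.take j) i
      rw [List.take_take, min_eq_left hij.le] at this
      rw [Multiset.sum_coe]
      omega
  have hcard := Finset.card_le_card_of_injOn (s := Finset.range l.length)
    (t := Finset.Icc (1 - (m : ℤ)) M) (fun k => (l.take k).sum)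
    (fun k _ => by simpa using hl k) (by
      intro i hi j hj hij
      simp only [Finset.coe_range, Set.mem_Iio] at hi hj
      rcases lt_trichotomy i j with h | h | h
      · exact absurd hij (hne i j h hj)
      · exact h
      · exact absurd hij.symm (hne j i h hi))
  rw [Finset.card_range, Int.card_Icc] at hcard
  rw [Multiset.coe_card]
  omega

theorem isMinZeroSum_replicate_add_replicate_s7 {m M : ℕ} (hM : 0 < M)
    (h : Nat.Coprime M m) :
    IsMinZeroSum (Multiset.replicate M (-(m : ℤ)) + Multiset.replicate m (M : ℤ)) := by
  refine ⟨by simp [mul_comm], fun T hT hT0 hTS hsum => ?_⟩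
  obtain ⟨a, ha, hTa⟩ := Multiset.le_replicate_iff.mp (tsub_le_iff_right.mpr hT)
  obtain ⟨b, hb, hTb⟩ := Multiset.le_replicate_iff.mp
    (Multiset.inter_le_right (s := T) (t := Multiset.replicate m (M : ℤ)))
  have hT' := Multiset.sub_add_inter T (Multiset.replicate m (M : ℤ))
  rw [hTa, hTb] at hT'
  subst hT'
  simp only [Multiset.sum_add, Multiset.sum_replicate, nsmul_eq_mul] at hsum
  have hab : a * m = b * M := by
    zify
    linarith
  have hdvd : M ∣ a := h.dvd_of_dvd_mul_right ⟨b, by rw [hab, mul_comm]⟩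
  rcases Nat.eq_zero_or_pos a with rfl | ha0
  · have : b = 0 := by
      rw [zero_mul] at hab
      rcases Nat.mul_eq_zero.mp hab.symm with h | h <;> omega
    subst this
    exact hT0 (by simp)
  · obtain rfl : a = M := le_antisymm ha (Nat.le_of_dvd ha0 hdvd)
    obtain rfl : m = b := Nat.eq_of_mul_eq_mul_left hM (by rw [hab, mul_comm])
    exact hTS rfl

theorem stmt_7 (m M : ℕ) (hm : 0 < m) (hM : 0 < M) (h : rho m M = 0) :
    (davenport m M : ℤ) = (m : ℤ) + (M : ℤ) := by
  have hgreatest : IsGreatest {n : ℕ | ∃ S : Multiset ℤ, IsMinZeroSum S ∧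
      (∀ x ∈ S, -(m : ℤ) ≤ x ∧ x ≤ (M : ℤ)) ∧ S.card = n} (m + M) := by
    refine ⟨⟨_, isMinZeroSum_replicate_add_replicate_s7 hM (coprime_of_rho_eq_zero hM h),
      fun x hx => ?_, by simp [add_comm]⟩, ?_⟩
    · rcases Multiset.mem_add.mp hx with hx | hx <;>
      · rw [Multiset.eq_of_mem_replicate hx]
        omega
    · rintro n ⟨S, hS, hb, rfl⟩
      exact hS.card_le hm hb
  rw [davenport, hgreatest.csSup_eq, Nat.cast_add]
end

section
/- Let m and M be positive integers, let α and β be positive integers, and let S be the multiset consisting of α copies of M and β copies of -m. Then S is a minimal zero-sum multiset if and only if α = m/gcd(m,M) and β = M/gcd(m,M); in that case the cardinality of S equals (m+M)/gcd(m,M). -/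
theorem Multiset.exists_replicate_add_replicate_of_le {ι : Type*} {x y : ι} {a b : ℕ}
    {T : Multiset ι} (h : T ≤ Multiset.replicate a x + Multiset.replicate b y) :
    ∃ p q, p ≤ a ∧ q ≤ b ∧ T = Multiset.replicate p x + Multiset.replicate q y := by
  classical
  obtain ⟨p, hp, hp'⟩ := Multiset.le_replicate_iff.1
    (Multiset.inter_le_right : T ∩ Multiset.replicate a x ≤ Multiset.replicate a x)
  obtain ⟨q, hq, hq'⟩ := Multiset.le_replicate_iff.1
    (tsub_le_iff_left.2 h : T - Multiset.replicate a x ≤ Multiset.replicate b y)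
  refine ⟨p, q, hp, hq, ?_⟩
  rw [← hp', ← hq', add_comm, Multiset.sub_add_inter]

theorem sum_replicate_add_replicate_neg_eq_zero_iff {g a b : ℕ} (hg : 0 < g) (p q : ℕ) :
    (Multiset.replicate p ((g * b : ℕ) : ℤ) +
      Multiset.replicate q (-((g * a : ℕ) : ℤ))).sum = 0 ↔ p * b = q * a := by
  have hg' : (g : ℤ) ≠ 0 := by positivity
  have h : (Multiset.replicate p ((g * b : ℕ) : ℤ) +
      Multiset.replicate q (-((g * a : ℕ) : ℤ))).sum =
      (g : ℤ) * (((p * b : ℕ) : ℤ) - ((q * a : ℕ) : ℤ)) := by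
    simp only [Multiset.sum_add, Multiset.sum_replicate, nsmul_eq_mul]
    push_cast
    ring
  rw [h, mul_eq_zero, or_iff_right hg', sub_eq_zero, Nat.cast_inj]

theorem isMinZeroSum_replicate_add_replicate_iff {g a b α β : ℕ} (hg : 0 < g) (ha : 0 < a)
    (hb : 0 < b) (hab : Nat.Coprime a b) (hα : 0 < α) :
    IsMinZeroSum (Multiset.replicate α ((g * b : ℕ) : ℤ) +
      Multiset.replicate β (-((g * a : ℕ) : ℤ))) ↔ α = a ∧ β = b := by
  constructor
  · rintro ⟨hsum, hmin⟩
    rw [sum_replicate_add_replicate_neg_eq_zero_iff hg] at hsum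
    obtain ⟨k, rfl⟩ : a ∣ α := hab.dvd_of_dvd_mul_right ⟨β, by rw [hsum, mul_comm]⟩
    obtain rfl : β = b * k := Nat.eq_of_mul_eq_mul_right ha (by rw [← hsum]; ring)
    have hk : 1 ≤ k := Nat.pos_of_mul_pos_left hα
    by_contra hne
    refine hmin (Multiset.replicate a ((g * b : ℕ) : ℤ) +
      Multiset.replicate b (-((g * a : ℕ) : ℤ))) ?_ ?_ ?_
      ((sum_replicate_add_replicate_neg_eq_zero_iff hg a b).2 (mul_comm a b))
    · exact add_le_add (Multiset.replicate_mono _ (Nat.le_mul_of_pos_right a hk))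
        (Multiset.replicate_mono _ (Nat.le_mul_of_pos_right b hk))
    · intro h
      have := congrArg Multiset.card h
      simp only [Multiset.card_add, Multiset.card_replicate, Multiset.card_zero] at this
      omega
    · intro h
      have := congrArg Multiset.card h
      simp only [Multiset.card_add, Multiset.card_replicate] at this
      have h₁ := Nat.le_mul_of_pos_right a hk
      have h₂ := Nat.le_mul_of_pos_right b hk
      exact hne ⟨by omega, by omega⟩
  · rintro ⟨rfl, rfl⟩
    refine ⟨(sum_replicate_add_replicate_neg_eq_zero_iff hg _ _).2 (mul_comm _ _), ?_⟩
    intro T hT hT0 hTS hsum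
    obtain ⟨p, q, hp, -, rfl⟩ := Multiset.exists_replicate_add_replicate_of_le hT
    rw [sum_replicate_add_replicate_neg_eq_zero_iff hg] at hsum
    have hdvd : α ∣ p := hab.dvd_of_dvd_mul_right ⟨q, by rw [hsum, mul_comm]⟩
    rcases Nat.eq_zero_or_pos p with rfl | hp0
    · obtain rfl : q = 0 := by
        rw [zero_mul, eq_comm, mul_eq_zero] at hsum
        omega
      simp at hT0
    · obtain rfl : p = α := le_antisymm hp (Nat.le_of_dvd hp0 hdvd)
      obtain rfl : q = β := Nat.eq_of_mul_eq_mul_right ha (by rw [← hsum, mul_comm])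
      exact hTS rfl

theorem stmt_9 (m M : ℕ) (hm : 0 < m) (hM : 0 < M)
    (α β : ℕ) (hα : 0 < α) (hβ : 0 < β) (S : Multiset ℤ)
    (hS : S = Multiset.replicate α (M : ℤ) + Multiset.replicate β (-(m : ℤ))) :
    (IsMinZeroSum S ↔ (α = m / Nat.gcd m M ∧ β = M / Nat.gcd m M)) ∧
    (IsMinZeroSum S → S.card = (m + M) / Nat.gcd m M) := by
  have hg : 0 < Nat.gcd m M := Nat.gcd_pos_of_pos_left M hm
  have hiff : IsMinZeroSum S ↔ (α = m / Nat.gcd m M ∧ β = M / Nat.gcd m M) := by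
    have h := isMinZeroSum_replicate_add_replicate_iff (β := β) hg
      (Nat.div_gcd_pos_of_pos_left M hm) (Nat.div_gcd_pos_of_pos_right m hM)
      (Nat.coprime_div_gcd_div_gcd hg) hα
    rwa [Nat.mul_div_cancel' (Nat.gcd_dvd_left m M),
      Nat.mul_div_cancel' (Nat.gcd_dvd_right m M), ← hS] at h
  refine ⟨hiff, fun h => ?_⟩
  obtain ⟨h₁, h₂⟩ := hiff.1 h
  rw [hS, Multiset.card_add, Multiset.card_replicate, Multiset.card_replicate,
    Nat.add_div_of_dvd_right (Nat.gcd_dvd_left m M), ← h₁, ← h₂]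
end

section
/- Let m and M be positive integers such that D(⟦-m,M⟧) = m + M. Then ρ(m,M) = 0, and the unique minimal zero-sum multiset with elements in ⟦-m,M⟧ of cardinality m + M is the multiset consisting of m copies of M and M copies of -m. -/
/-- A minimal zero-sum multiset over `⟦-m,M⟧` with an element `x` strictly between the endpoints is
exhausted by a growing chain of submultisets starting at `{x}`, whose sums are distinct elements
of `⟦-m+1,M-1⟧`. -/
lemma IsMinZeroSum.exists_chain {S : Multiset ℤ} (hS : IsMinZeroSum S) {m M x : ℤ}
    (hm : 0 < m) (hM : 0 < M) (hb : ∀ y ∈ S, -m ≤ y ∧ y ≤ M) (hx : x ∈ S)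
    (hx₁ : -m < x) (hx₂ : x < M) (k : ℕ) (hk : k + 1 ≤ S.card) :
    ∃ T ≤ S, T.card = k + 1 ∧ T.sum ∈ Finset.Icc (-m + 1) (M - 1) ∧
      ∃ V ⊆ Finset.Icc (-m + 1) (M - 1), V.card = k + 1 ∧ ∀ v ∈ V, ∃ U < T, U.sum = v := by
  induction k with
  | zero =>
    refine ⟨{x}, by simpa using hx, by simp, by simp; lia, {0}, ?_, by simp, ?_⟩
    · simp
      lia
    · intro v hv
      refine ⟨0, ?_, by simp_all⟩
      exact bot_lt_iff_ne_bot.2 (by simp)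
  | succ k ih =>
    obtain ⟨T, hTS, hTc, hTs, V, hV, hVc, hVU⟩ := ih (by lia)
    have hT0 : T ≠ 0 := by
      rintro rfl
      simp at hTc
    have hTne : T ≠ S := by
      rintro rfl
      lia
    have hs := hS.2 T hTS hT0 hTne
    have hsum : T.sum + (S - T).sum = 0 := by
      rw [← Multiset.sum_add, add_tsub_cancel_of_le hTS, hS.1]
    rw [Finset.mem_Icc] at hTs
    obtain ⟨y, hy, hys⟩ : ∃ y ∈ S - T, T.sum + y ∈ Finset.Icc (-m + 1) (M - 1) := by
      have hb' : ∀ y ∈ S - T, -m ≤ y ∧ y ≤ M := fun y hy =>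
        hb y (Multiset.mem_of_le (Multiset.sub_le_self _ _) hy)
      by_contra! hcon
      simp only [Finset.mem_Icc, not_and, not_le] at hcon
      rcases lt_or_gt_of_ne hs with h | h
      · have := Multiset.sum_nonneg (s := (S - T).map Neg.neg) (by
          intro z hz
          obtain ⟨y, hy, rfl⟩ := Multiset.mem_map.1 hz
          have := hcon y hy
          have := hb' y hy
          lia)
        rw [Multiset.sum_map_neg'] at this
        simp at this
        lia
      · have := Multiset.sum_nonneg (s := S - T) (by
          intro y hy
          have := hcon y hy
          have := hb' y hy
          lia)
        lia
    refine ⟨y ::ₘ T, ?_, by simp [hTc], by simpa [add_comm] using hys, insert T.sum V, ?_, ?_, ?_⟩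
    · calc y ::ₘ T = {y} + T := rfl
        _ ≤ (S - T) + T := by gcongr; simpa using hy
        _ = S := tsub_add_cancel_of_le hTS
    · exact Finset.insert_subset (by simpa using hTs) hV
    · rw [Finset.card_insert_of_notMem, hVc]
      intro hmem
      obtain ⟨U, hU, hUs⟩ := hVU _ hmem
      have hsub : U.sum + (T - U).sum = T.sum := by
        rw [← Multiset.sum_add, add_tsub_cancel_of_le hU.le]
      refine hS.2 (T - U) ((Multiset.sub_le_self _ _).trans hTS) ?_ ?_ (by lia)
      · intro h
        exact hU.not_ge (tsub_eq_zero_iff_le.1 h)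
      · intro h
        exact hTne (le_antisymm hTS (h ▸ Multiset.sub_le_self _ _))
    · have hlt : T < y ::ₘ T := Multiset.lt_cons_self T y
      intro v hv
      rcases Finset.mem_insert.1 hv with rfl | hv
      · exact ⟨T, hlt, rfl⟩
      · obtain ⟨U, hU, hUs⟩ := hVU v hv
        exact ⟨U, hU.trans hlt, hUs⟩

lemma IsMinZeroSum.card_lt_of_mem {S : Multiset ℤ} (hS : IsMinZeroSum S) {m M x : ℤ}
    (hm : 0 < m) (hM : 0 < M) (hb : ∀ y ∈ S, -m ≤ y ∧ y ≤ M) (hx : x ∈ S)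
    (hx₁ : -m < x) (hx₂ : x < M) : (S.card : ℤ) < m + M := by
  have hpos : 0 < S.card := Multiset.card_pos_iff_exists_mem.2 ⟨x, hx⟩
  obtain ⟨-, -, -, -, V, hV, hVc, -⟩ :=
    hS.exists_chain hm hM hb hx hx₁ hx₂ (S.card - 1) (by lia)
  have := Finset.card_le_card hV
  rw [Int.card_Icc] at this
  lia

lemma IsMinZeroSum.eq_replicate_add_replicate {S : Multiset ℤ} (hS : IsMinZeroSum S) {m M : ℕ}
    (hm : 0 < m) (hM : 0 < M) (hb : ∀ y ∈ S, -(m : ℤ) ≤ y ∧ y ≤ (M : ℤ))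
    (hc : S.card = m + M) :
    S = Multiset.replicate m (M : ℤ) + Multiset.replicate M (-(m : ℤ)) := by
  have hmem : ∀ x ∈ S, x ≠ (M : ℤ) → x = -(m : ℤ) := by
    intro x hx hxM
    by_contra hxm
    have := hb x hx
    have := hS.card_lt_of_mem (by lia) (by lia) hb hx (by lia) (by lia)
    lia
  obtain ⟨a, b, rfl⟩ : ∃ a b : ℕ,
      S = Multiset.replicate a (M : ℤ) + Multiset.replicate b (-(m : ℤ)) := by
    refine ⟨(S.filter (· = (M : ℤ))).card, (S.filter (¬ · = (M : ℤ))).card, ?_⟩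
    conv_lhs => rw [← Multiset.filter_add_not (· = (M : ℤ)) S]
    congr 1
    · exact Multiset.eq_replicate.2 ⟨rfl, fun x hx => (Multiset.mem_filter.1 hx).2⟩
    · refine Multiset.eq_replicate.2 ⟨rfl, fun x hx => ?_⟩
      exact hmem x (Multiset.mem_filter.1 hx).1 (Multiset.mem_filter.1 hx).2
  have hsum := hS.1
  simp at hc hsum
  have hbm : b = m + M - a := by lia
  have ha : a = m := by
    zify at hc ⊢
    have : ((m : ℤ) + M) * (a - m) = 0 := by linear_combination hsum + (m : ℤ) * hc
    rcases mul_eq_zero.1 this with h | h <;> lia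
  have : b = M := by lia
  rw [ha, this]

lemma IsMinZeroSum.coprime_of_replicate {m M : ℕ} (hm : 0 < m)
    (hS : IsMinZeroSum (Multiset.replicate m (M : ℤ) + Multiset.replicate M (-(m : ℤ)))) :
    Nat.Coprime M m := by
  have hg : 0 < Nat.gcd M m := Nat.gcd_pos_of_pos_right _ hm
  obtain ⟨a, ha⟩ := Nat.gcd_dvd_right M m
  obtain ⟨b, hb⟩ := Nat.gcd_dvd_left M m
  rw [Nat.coprime_iff_gcd_eq_one]
  set g := Nat.gcd M m
  have ham : a ≤ m := by nlinarith
  have hbM : b ≤ M := by nlinarith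
  have ha0 : 0 < a := Nat.pos_of_ne_zero (by rintro rfl; lia)
  by_contra hg1
  refine hS.2 (Multiset.replicate a (M : ℤ) + Multiset.replicate b (-(m : ℤ))) ?_ ?_ ?_ ?_
  · exact add_le_add ((Multiset.replicate_le_replicate _).2 ham)
      ((Multiset.replicate_le_replicate _).2 hbM)
  · intro h
    have := congrArg Multiset.card h
    simp at this
    lia
  · intro h
    have h := congrArg Multiset.card h
    simp at h
    have : 2 ≤ g := by lia
    nlinarith
  · have ha' : (m : ℤ) = g * a := by exact_mod_cast ha
    have hb' : (M : ℤ) = g * b := by exact_mod_cast hb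
    simp
    linear_combination a * hb' - b * ha'

theorem stmt_10 (m M : ℕ) (hm : 0 < m) (hM : 0 < M)
    (hD : davenport m M = m + M) :
    rho m M = 0 ∧ ∀ S : Multiset ℤ, IsMinZeroSum S →
      (∀ x ∈ S, -(m : ℤ) ≤ x ∧ x ≤ (M : ℤ)) → S.card = m + M →
      S = Multiset.replicate m (M : ℤ) + Multiset.replicate M (-(m : ℤ)) := by
  refine ⟨?_, fun S hS hb hc => hS.eq_replicate_add_replicate hm hM hb hc⟩
  unfold davenport at hD
  set A := {n : ℕ | ∃ S : Multiset ℤ, IsMinZeroSum S ∧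
    (∀ x ∈ S, -(m : ℤ) ≤ x ∧ x ≤ (M : ℤ)) ∧ S.card = n}
  have hne : A.Nonempty := by
    by_contra h
    rw [Set.not_nonempty_iff_eq_empty.1 h, csSup_empty, bot_eq_zero] at hD
    lia
  have hbdd : BddAbove A := by
    by_contra h
    rw [Nat.sSup_of_not_bddAbove h] at hD
    lia
  obtain ⟨S, hS, hb, hc⟩ := Nat.sSup_mem hne hbdd
  have hSeq := hS.eq_replicate_add_replicate hm hM hb (hc.trans hD)
  rw [hSeq] at hS
  have hcop := hS.coprime_of_replicate hm
  refine Nat.sInf_eq_zero.2 (Or.inl ⟨0, le_rfl, ?_⟩)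
  simpa using hcop
end

section
/- Let m and M be integers with m, M ≥ 2, and let S be a minimal zero-sum multiset whose elements all lie in ⟦-m,M⟧ and which contains at least two elements (counted with multiplicity) different from both -m and M. Then at least one of the following holds: (i) there exists a list l whose underlying multiset is S such that every nonempty prefix of l has its sum in ⟦-(m-1), M-2⟧; (ii) there exists a list l whose underlying multiset is S such that every nonempty prefix of l has its sum in ⟦-(m-2), M-1⟧; (iii) every element of S different from both -m and M equals M-1, or every element of S different from both -m and M equals -(m-1). -/
/-- Some ordering of `R`, started at `s`, has all its partial sums in `[lo, hi]`. -/
def HasBoundedOrdering (lo hi : ℤ) (R : Multiset ℤ) (s : ℤ) : Prop :=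
  ∃ l : List ℤ, (l : Multiset ℤ) = R ∧ ∀ k, 0 < k → k ≤ l.length →
    lo ≤ s + (l.take k).sum ∧ s + (l.take k).sum ≤ hi

namespace HasBoundedOrdering

theorem zero (lo hi s : ℤ) : HasBoundedOrdering lo hi 0 s :=
  ⟨[], rfl, fun k hk hk' => by simp at hk'; omega⟩

theorem cons {lo hi s x : ℤ} {R : Multiset ℤ} (hlo : lo ≤ s + x) (hhi : s + x ≤ hi)
    (h : HasBoundedOrdering lo hi R (s + x)) : HasBoundedOrdering lo hi (x ::ₘ R) s := by
  obtain ⟨l, rfl, hl⟩ := h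
  refine ⟨x :: l, rfl, fun k hk hk' => ?_⟩
  obtain ⟨k, rfl⟩ : ∃ j, k = j + 1 := ⟨k - 1, by omega⟩
  rw [List.take_succ_cons, List.sum_cons, ← add_assoc]
  rcases Nat.eq_zero_or_pos k with rfl | hk0
  · simpa using ⟨hlo, hhi⟩
  · exact hl k hk0 (by simpa using hk')

theorem of_nonneg {lo hi : ℤ} (R : Multiset ℤ) (s : ℤ) (hR : ∀ x ∈ R, 0 ≤ x)
    (hlo : lo ≤ s) (hhi : s + R.sum ≤ hi) : HasBoundedOrdering lo hi R s := by
  induction R using Multiset.induction_on generalizing s with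
  | empty => exact zero lo hi s
  | cons x R ih =>
    have hx := hR x (Multiset.mem_cons_self x R)
    have hR' : ∀ z ∈ R, 0 ≤ z := fun z hz => hR z (Multiset.mem_cons_of_mem hz)
    have hsum := Multiset.sum_nonneg hR'
    rw [Multiset.sum_cons] at hhi
    exact cons (by omega) (by omega) (ih _ hR' (by omega) (by omega))

theorem of_nonpos {lo hi : ℤ} (R : Multiset ℤ) (s : ℤ) (hR : ∀ x ∈ R, x ≤ 0)
    (hhi : s ≤ hi) (hlo : lo ≤ s + R.sum) : HasBoundedOrdering lo hi R s := by
  induction R using Multiset.induction_on generalizing s with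
  | empty => exact zero lo hi s
  | cons x R ih =>
    have hx := hR x (Multiset.mem_cons_self x R)
    have hR' : ∀ z ∈ R, z ≤ 0 := fun z hz => hR z (Multiset.mem_cons_of_mem hz)
    have hsum : R.sum ≤ 0 := by
      simpa using Multiset.sum_le_card_nsmul R 0 hR'
    rw [Multiset.sum_cons] at hlo
    exact cons (by omega) (by omega) (ih _ hR' (by omega) (by omega))

/-- A zero-sum free multiset can be ordered within the window if the partial sum `-1` never
occurs. -/
theorem of_avoids_neg_one {m M : ℤ} (R : Multiset ℤ) (s : ℤ)
    (hmem : ∀ x ∈ R, -m ≤ x ∧ x ≤ M) (hfree : ∀ T ≤ R, T ≠ 0 → T.sum ≠ 0)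
    (havoid : ∀ T ≤ R, s + T.sum ≠ -1) (hs : s + R.sum = 0)
    (hlo : -(m - 1) ≤ s) (hhi : s ≤ M - 2) :
    HasBoundedOrdering (-(m - 1)) (M - 2) R s := by
  induction hn : R.card generalizing R s with
  | zero => rw [Multiset.card_eq_zero.1 hn]; exact zero _ _ s
  | succ n ih =>
    have hR0 : R ≠ 0 := by rintro rfl; simp at hn
    have hsum := hfree R le_rfl hR0
    have hs1 : s ≠ -1 := by simpa using havoid 0 (Multiset.zero_le R)
    obtain ⟨x, hxR, hlo', hhi'⟩ : ∃ x ∈ R, -(m - 1) ≤ s + x ∧ s + x ≤ M - 2 := by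
      rcases lt_or_ge 0 s with h | h
      · obtain ⟨x, hx, hx0⟩ : ∃ x ∈ R, x < 0 := by
          by_contra! hc
          have := Multiset.sum_nonneg hc
          omega
        have := hmem x hx
        exact ⟨x, hx, by omega, by omega⟩
      · obtain ⟨x, hx, hx0⟩ : ∃ x ∈ R, 0 < x := by
          by_contra! hc
          have : R.sum ≤ 0 := by simpa using Multiset.sum_le_card_nsmul R 0 hc
          omega
        have := hmem x hx
        exact ⟨x, hx, by omega, by omega⟩
    obtain ⟨R, rfl⟩ := Multiset.exists_cons_of_mem hxR
    have hle := Multiset.le_cons_self R x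
    refine cons hlo' hhi' (ih R _ (fun z hz => hmem z (Multiset.mem_cons_of_mem hz))
      (fun T hT => hfree T (hT.trans hle)) (fun T hT => ?_) ?_ hlo' hhi' (by simpa using hn))
    · have := havoid (x ::ₘ T) ((Multiset.cons_le_cons_iff x).2 hT)
      rwa [Multiset.sum_cons, ← add_assoc] at this
    · rwa [Multiset.sum_cons, ← add_assoc] at hs

/-- A zero-sum free multiset can be ordered within the window if it contains an element `y` which
may be added at the partial sum `-1`. -/
theorem of_reserve {m M y : ℤ} (hm : 2 ≤ m) (hM : 2 ≤ M)
    (hylo : -(m - 2) ≤ y) (hyhi : y ≤ M - 1) (R : Multiset ℤ) (s : ℤ)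
    (hmem : ∀ x ∈ R, -m ≤ x ∧ x ≤ M) (hfree : ∀ T ≤ y ::ₘ R, T ≠ 0 → T.sum ≠ 0)
    (hs : s + (y ::ₘ R).sum = 0) (hlo : -(m - 1) ≤ s) (hhi : s ≤ M - 2) :
    HasBoundedOrdering (-(m - 1)) (M - 2) (y ::ₘ R) s := by
  induction hn : R.card using Nat.strong_induction_on generalizing R s with
  | _ n ih =>
    have hsum := hfree _ le_rfl (Multiset.cons_ne_zero)
    have hs' := hs
    rw [Multiset.sum_cons] at hs'
    by_cases hs1 : s = -1
    · subst hs1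
      refine cons (by omega) (by omega) (of_avoids_neg_one R _ hmem
        (fun T hT => hfree T (hT.trans (Multiset.le_cons_self R y))) (fun T hT h => ?_)
        (by omega) (by omega) (by omega))
      refine hfree (y ::ₘ T) ((Multiset.cons_le_cons_iff y).2 hT) (Multiset.cons_ne_zero) ?_
      rw [Multiset.sum_cons]
      omega
    have step : ∀ x ∈ R, -(m - 1) ≤ s + x → s + x ≤ M - 2 →
        HasBoundedOrdering (-(m - 1)) (M - 2) (y ::ₘ R) s := by
      intro x hx hlo' hhi'
      obtain ⟨R, rfl⟩ := Multiset.exists_cons_of_mem hx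
      rw [Multiset.cons_swap] at hfree ⊢
      refine cons hlo' hhi' (ih R.card (by simp at hn; omega) R _
        (fun z hz => hmem z (Multiset.mem_cons_of_mem hz))
        (fun T hT => hfree T (hT.trans (Multiset.le_cons_self _ x))) ?_ hlo' hhi' rfl)
      rw [Multiset.sum_cons] at hs' ⊢
      omega
    rcases lt_or_ge 0 s with h | h
    · by_cases hneg : ∃ x ∈ R, x < 0
      · obtain ⟨x, hx, hx0⟩ := hneg
        have := hmem x hx
        exact step x hx (by omega) (by omega)
      · push Not at hneg
        have := Multiset.sum_nonneg hneg
        exact cons (by omega) (by omega) (of_nonneg R _ hneg (by omega) (by omega))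
    · by_cases hpos : ∃ x ∈ R, 0 < x
      · obtain ⟨x, hx, hx0⟩ := hpos
        have := hmem x hx
        exact step x hx (by omega) (by omega)
      · push Not at hpos
        have : R.sum ≤ 0 := by simpa using Multiset.sum_le_card_nsmul R 0 hpos
        exact cons (by omega) (by omega) (of_nonpos R _ hpos (by omega) (by omega))

end HasBoundedOrdering

/-- A minimal zero-sum multiset can be ordered within the window if it contains an element `x` which
may be added at `0` and another element `y` which may be added at `-1`. -/
theorem IsMinZeroSum.hasBoundedOrdering {m M x y : ℤ} {R : Multiset ℤ} (hm : 2 ≤ m) (hM : 2 ≤ M)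
    (hS : IsMinZeroSum (x ::ₘ y ::ₘ R)) (hmem : ∀ z ∈ R, -m ≤ z ∧ z ≤ M)
    (hxlo : -(m - 1) ≤ x) (hxhi : x ≤ M - 2) (hylo : -(m - 2) ≤ y) (hyhi : y ≤ M - 1) :
    HasBoundedOrdering (-(m - 1)) (M - 2) (x ::ₘ y ::ₘ R) 0 := by
  refine .cons (by omega) (by omega) (.of_reserve hm hM hylo hyhi R _ hmem
    (fun T hT hT0 => ?_) ?_ (by omega) (by omega))
  · exact hS.2 T (hT.trans (Multiset.le_cons_self _ x)) hT0
      (hT.trans_lt (Multiset.lt_cons_self _ x)).ne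
  · rw [zero_add, ← Multiset.sum_cons]
    exact hS.1

theorem stmt_11 (m M : ℕ) (hm : 2 ≤ m) (hM : 2 ≤ M) (S : Multiset ℤ)
    (hS : IsMinZeroSum S) (hmem : ∀ x ∈ S, -(m : ℤ) ≤ x ∧ x ≤ (M : ℤ))
    (h2 : 2 ≤ (S.filter (fun x => x ≠ -(m : ℤ) ∧ x ≠ (M : ℤ))).card) :
    (∃ l : List ℤ, (l : Multiset ℤ) = S ∧ ∀ k, 0 < k → k ≤ l.length →
      -((m : ℤ) - 1) ≤ (l.take k).sum ∧ (l.take k).sum ≤ (M : ℤ) - 2) ∨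
    (∃ l : List ℤ, (l : Multiset ℤ) = S ∧ ∀ k, 0 < k → k ≤ l.length →
      -((m : ℤ) - 2) ≤ (l.take k).sum ∧ (l.take k).sum ≤ (M : ℤ) - 1) ∨
    ((∀ x ∈ S, x ≠ -(m : ℤ) → x ≠ (M : ℤ) → x = (M : ℤ) - 1) ∨
     (∀ x ∈ S, x ≠ -(m : ℤ) → x ≠ (M : ℤ) → x = -((m : ℤ) - 1))) := by
  by_cases hpair : ∃ x y : ℤ, ∃ R : Multiset ℤ, S = x ::ₘ y ::ₘ R ∧
      (x ≠ -(m : ℤ) ∧ x ≠ (M : ℤ)) ∧ (y ≠ -(m : ℤ) ∧ y ≠ (M : ℤ)) ∧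
      x ≠ (M : ℤ) - 1 ∧ y ≠ -((m : ℤ) - 1)
  · obtain ⟨x, y, R, rfl, hx, hy, hxM, hym⟩ := hpair
    have hxb := hmem x (by simp)
    have hyb := hmem y (by simp)
    obtain ⟨l, hl, hb⟩ := hS.hasBoundedOrdering (m := m) (M := M) (by omega) (by omega)
      (fun z hz => hmem z (by simp [hz])) (by omega) (by omega) (by omega) (by omega)
    exact Or.inl ⟨l, hl, by simpa only [zero_add] using hb⟩
  · refine Or.inr (Or.inr ?_)
    by_contra! hcon
    obtain ⟨⟨x, hxS, hxm, hxM, hx⟩, ⟨z, hzS, hzm, hzM, hz⟩⟩ := hcon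
    obtain ⟨R, rfl⟩ := Multiset.exists_cons_of_mem hxS
    by_cases hzx : z = x
    · subst hzx
      rw [Multiset.filter_cons_of_pos _ ⟨hxm, hxM⟩, Multiset.card_cons] at h2
      obtain ⟨y, hy⟩ := Multiset.card_pos_iff_exists_mem.1 (Nat.le_of_succ_le_succ h2)
      obtain ⟨hyR, hyi⟩ := Multiset.mem_filter.1 hy
      obtain ⟨Q, rfl⟩ := Multiset.exists_cons_of_mem hyR
      by_cases hym : y = -((m : ℤ) - 1)
      · exact hpair ⟨y, z, Q, Multiset.cons_swap _ _ _, hyi, ⟨hxm, hxM⟩, by omega, hz⟩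
      · exact hpair ⟨z, y, Q, rfl, ⟨hxm, hxM⟩, hyi, hx, hym⟩
    · obtain ⟨Q, rfl⟩ := Multiset.exists_cons_of_mem
        ((Multiset.mem_cons.1 hzS).resolve_left hzx)
      exact hpair ⟨x, z, Q, rfl, ⟨hxm, hxM⟩, ⟨hzm, hzM⟩, hx, hz⟩
end

section
/- Let m and M be positive integers with gcd(m,M) ≠ 1, let α, β, γ be natural numbers, and let S be the multiset consisting of α copies of M, β copies of M-1, and γ copies of -m. Assume S is a minimal zero-sum multiset. Then: if α > 0 the cardinality of S is at most m + M - 2, and if gcd(m, M-1) ≠ 1 the cardinality of S is at most m + M - 3. -/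
theorem exists_small_multiple_dvd {m X : ℕ} (hm : 0 < m) (h : Nat.gcd m X ≠ 1) :
    ∃ p : ℕ, 0 < p ∧ 2 * p ≤ m ∧ (m : ℤ) ∣ p * (X : ℤ) := by
  obtain ⟨p, hp⟩ := Nat.gcd_dvd_left m X
  obtain ⟨k, hk⟩ := Nat.gcd_dvd_right m X
  have hd : 0 < Nat.gcd m X := Nat.gcd_pos_of_pos_left X hm
  generalize Nat.gcd m X = d at *
  refine ⟨p, Nat.pos_of_ne_zero ?_, ?_, k, ?_⟩
  · rintro rfl
    omega
  · have : 2 ≤ d := by omega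
    calc 2 * p ≤ d * p := Nat.mul_le_mul_right p this
      _ = m := hp.symm
  · rw [hp, hk]
    push_cast
    ring

theorem IsMinZeroSum.eq_zero_or_eq_of_dvd {m α β γ : ℕ} {x y : ℤ} (hm : 0 < m)
    (hx : 0 ≤ x) (hy : 0 ≤ y)
    (hmin : IsMinZeroSum (Multiset.replicate α x + Multiset.replicate β y +
      Multiset.replicate γ (-(m : ℤ))))
    {a b : ℕ} (ha : a ≤ α) (hb : b ≤ β) (hdvd : (m : ℤ) ∣ a * x + b * y) :
    (a = 0 ∧ b = 0) ∨ (a = α ∧ b = β) := by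
  obtain ⟨hsum, hsub⟩ := hmin
  simp only [Multiset.sum_add, Multiset.sum_replicate, nsmul_eq_mul] at hsum
  obtain ⟨c, hc⟩ := hdvd
  have hm' : (0 : ℤ) < m := by exact_mod_cast hm
  have hax : (a : ℤ) * x ≤ α * x := mul_le_mul_of_nonneg_right (by exact_mod_cast ha) hx
  have hby : (b : ℤ) * y ≤ β * y := mul_le_mul_of_nonneg_right (by exact_mod_cast hb) hy
  have hc0 : 0 ≤ c := by
    refine nonneg_of_mul_nonneg_right (a := (m : ℤ)) ?_ hm'
    rw [← hc]
    positivity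
  lift c to ℕ using hc0
  have hcγ : c ≤ γ := by
    have : (m : ℤ) * c ≤ m * γ := by linarith
    exact_mod_cast le_of_mul_le_mul_left this hm'
  by_contra! hne
  refine hsub (Multiset.replicate a x + Multiset.replicate b y +
    Multiset.replicate c (-(m : ℤ))) ?_ ?_ ?_ ?_
  · exact add_le_add (add_le_add ((Multiset.replicate_le_replicate _).2 ha)
      ((Multiset.replicate_le_replicate _).2 hb)) ((Multiset.replicate_le_replicate _).2 hcγ)
  · intro h
    have := congrArg Multiset.card h
    simp only [Multiset.card_add, Multiset.card_replicate, Multiset.card_zero] at this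
    omega
  · intro h
    have := congrArg Multiset.card h
    simp only [Multiset.card_add, Multiset.card_replicate] at this
    omega
  · simp only [Multiset.sum_add, Multiset.sum_replicate, nsmul_eq_mul]
    linarith

/-- A minimal zero-sum sequence modulo `m` that consists of two distinct residues has
length less than `m`. -/
theorem add_lt_of_minimal_zero_sum_mod {m α β : ℕ} {x y : ℤ} (hm : 0 < m) (hα : 0 < α)
    (hβ : 0 < β) (hxy : ¬ (m : ℤ) ∣ x - y)
    (hmin : ∀ a b : ℕ, a ≤ α → b ≤ β → (m : ℤ) ∣ a * x + b * y →
      (a = 0 ∧ b = 0) ∨ (a = α ∧ b = β)) :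
    α + β < m := by
  by_contra! hle
  let u : ℕ → ℕ := fun t => if t < 2 then 0 else 1 + (t - 2 - β)
  let v : ℕ → ℕ := fun t => if t < 2 then t else min (t - 2) β
  let f : ℕ → ℤ := fun t => (u t * x + v t * y) % m
  have hm' : (0 : ℤ) < m := by exact_mod_cast hm
  obtain ⟨s, hs, t, ht, hst, hf⟩ : ∃ s ∈ Finset.range (m + 1), ∃ t ∈ Finset.range (m + 1),
      s ≠ t ∧ f s = f t := by
    refine Finset.exists_ne_map_eq_of_card_lt_of_maps_to (t := Finset.Ico (0 : ℤ) m)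
      (by simp) fun t _ => ?_
    simpa [f] using ⟨Int.emod_nonneg _ hm'.ne', Int.emod_lt_of_pos _ hm'⟩
  wlog hlt : s < t generalizing s t
  · exact this t ht s hs hst.symm hf.symm (by omega)
  have hdvd : (m : ℤ) ∣ (u t * x + v t * y) - (u s * x + v s * y) := Int.ModEq.dvd hf
  rw [Finset.mem_range] at hs ht
  by_cases h12 : s = 1 ∧ t = 2
  · obtain ⟨rfl, rfl⟩ := h12
    exact hxy (by simpa [u, v] using hdvd)
  have hu : u s ≤ u t := by simp only [u]; split_ifs <;> omega
  have hv : v s ≤ v t := by simp only [v]; split_ifs <;> omega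
  have hut : u t ≤ α := by simp only [u]; split_ifs <;> omega
  have hvt : v t ≤ β := by simp only [v]; split_ifs <;> omega
  have := hmin (u t - u s) (v t - v s) (by omega) (by omega) (by
    rw [Nat.cast_sub hu, Nat.cast_sub hv]
    convert hdvd using 1
    ring)
  simp only [u, v] at this
  split_ifs at this <;> omega

theorem stmt_12 (m M : ℕ) (hm : 0 < m) (hM : 0 < M) (hgcd : Nat.gcd m M ≠ 1)
    (α β γ : ℕ) (S : Multiset ℤ)
    (hS : S = Multiset.replicate α (M : ℤ) + Multiset.replicate β ((M : ℤ) - 1) +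
      Multiset.replicate γ (-(m : ℤ)))
    (hmin : IsMinZeroSum S) :
    (0 < α → (S.card : ℤ) ≤ (m : ℤ) + (M : ℤ) - 2) ∧
    (Nat.gcd m (M - 1) ≠ 1 → (S.card : ℤ) ≤ (m : ℤ) + (M : ℤ) - 3) := by
  subst hS
  have hM1 : (0 : ℤ) ≤ (M : ℤ) - 1 := by omega
  have key : ∀ a b : ℕ, a ≤ α → b ≤ β → (m : ℤ) ∣ a * (M : ℤ) + b * ((M : ℤ) - 1) →
      (a = 0 ∧ b = 0) ∨ (a = α ∧ b = β) := fun a b ha hb =>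
    hmin.eq_zero_or_eq_of_dvd hm (by positivity) hM1 ha hb
  have hsum := hmin.1
  simp only [Multiset.sum_add, Multiset.sum_replicate, nsmul_eq_mul] at hsum
  simp only [Multiset.card_add, Multiset.card_replicate]
  have hm1 : m ≠ 1 := by
    rintro rfl
    simp at hgcd
  have hγ : α + β < m → γ < M := by
    intro h
    have h1 : ((α : ℤ) + β) * M < m * M :=
      mul_lt_mul_of_pos_right (by exact_mod_cast h) (by exact_mod_cast hM)
    have h2 : (m : ℤ) * γ < m * M := by linarith
    exact_mod_cast lt_of_mul_lt_mul_left h2 (by positivity)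
  obtain ⟨p, hp0, hp, hpM⟩ := exists_small_multiple_dvd hm hgcd
  have hα : p ≤ α → α = p ∧ β = 0 := by
    intro h
    have := key p 0 h (Nat.zero_le _) (by simpa using hpM)
    omega
  refine ⟨fun hα0 => ?_, fun hgcd' => ?_⟩
  · have hlt : α + β < m := by
      rcases Nat.eq_zero_or_pos β with hβ | hβ
      · omega
      · refine add_lt_of_minimal_zero_sum_mod hm hα0 hβ ?_ key
        rw [sub_sub_cancel]
        intro h
        exact hm1 (by exact_mod_cast Int.eq_one_of_dvd_one (by positivity) h)
    have := hγ hlt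
    omega
  · obtain ⟨q, hq0, hq, hqM⟩ := exists_small_multiple_dvd hm hgcd'
    rw [Nat.cast_sub hM, Nat.cast_one] at hqM
    have hβ : q ≤ β → β = q ∧ α = 0 := by
      intro h
      have := key 0 q (Nat.zero_le _) h (by simpa using hqM)
      omega
    have hm2 : m ≠ 2 := by
      rintro rfl
      rw [Ne, ← Nat.coprime_iff_gcd_eq_one, Nat.coprime_two_left, Nat.not_odd_iff] at hgcd hgcd'
      omega
    have hlt : α + β + 2 ≤ m := by omega
    have := hγ (by omega)
    omega
end
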